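/- There exists a constant C > 0 such that the following holds. Let u₀, u₁ be compactly supported smooth functions on ℝ², let f : [0,∞) × ℝ² → ℝ be smooth with compact support in the spatial variable for each time, and let u : [0,∞) × ℝ² → ℝ be the smooth solution of □u = f with u(0,·) = u₀ and ∂_t u(0,·) = u₁. Then for all t ≥ 0, ‖u(t,·)‖_{L²(ℝ²)} ≤ ‖u₀‖_{L²(ℝ²)} + C (1+t)^{1/2} { ‖u₁‖_{L^{4/3}(ℝ²)} + ∫₀ᵗ ( ‖χ₁(τ,·) f(τ,·)‖_{L^{4/3}(ℝ²)} + (1+τ)^{−1/2} ‖χ₂(τ,·) f(τ,·)‖_{L^{1,2}} ) dτ }. -/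

import Mathlib

open MeasureTheory ENNReal

noncomputable section

/-- A point of space-time `ℝ^{1+2}`: `p = (t, x₁, x₂)`. -/
abbrev Pt := ℝ × ℝ × ℝ

/-- The time derivative `∂ₜ`. -/
def vdt (u : Pt → ℝ) : Pt → ℝ := fun p => fderiv ℝ u p ((1:ℝ), (0:ℝ), (0:ℝ))

/-- The spatial derivative `∂₁`. -/
def vd1 (u : Pt → ℝ) : Pt → ℝ := fun p => fderiv ℝ u p ((0:ℝ), (1:ℝ), (0:ℝ))

/-- The spatial derivative `∂₂`. -/
def vd2 (u : Pt → ℝ) : Pt → ℝ := fun p => fderiv ℝ u p ((0:ℝ), (0:ℝ), (1:ℝ))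

/-- The rotation `Ω₁₂ = x₁∂₂ − x₂∂₁`. -/
def vOm (u : Pt → ℝ) : Pt → ℝ := fun p => p.2.1 * vd2 u p - p.2.2 * vd1 u p

/-- The scaling field `L₀ = t∂ₜ + x₁∂₁ + x₂∂₂`. -/
def vL0 (u : Pt → ℝ) : Pt → ℝ := fun p => p.1 * vdt u p + p.2.1 * vd1 u p + p.2.2 * vd2 u p

/-- The Lorentz boost `L₁ = t∂₁ + x₁∂ₜ`. -/
def vL1 (u : Pt → ℝ) : Pt → ℝ := fun p => p.1 * vd1 u p + p.2.1 * vdt u p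

/-- The Lorentz boost `L₂ = t∂₂ + x₂∂ₜ`. -/
def vL2 (u : Pt → ℝ) : Pt → ℝ := fun p => p.1 * vd2 u p + p.2.2 * vdt u p

/-- The wave operator `□ = ∂ₜ² − ∂₁² − ∂₂²`. -/
def box (u : Pt → ℝ) : Pt → ℝ := fun p => vdt (vdt u) p - vd1 (vd1 u) p - vd2 (vd2 u) p

/-- The mixed norm `‖g‖_{L^{1,2}} = ∫₀^∞ (∫_{S¹} |g(rξ)|² dσ(ξ))^{1/2} r dr`, the circle
integral being written in the arclength parametrization `ξ = (cos θ, sin θ)`. -/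
def L12norm (g : ℝ × ℝ → ℝ) : ℝ :=
  ∫ r in Set.Ioi (0:ℝ),
    Real.sqrt (∫ θ in Set.Ioc (0:ℝ) (2 * Real.pi), (g (r * Real.cos θ, r * Real.sin θ)) ^ 2) * r

/-- The region `{x ∈ ℝ² : |x| ≤ 1 + τ/2}` (where `χ₁(τ,·) = 1`). -/
def chi1Set (τ : ℝ) : Set (ℝ × ℝ) := {x : ℝ × ℝ | Real.sqrt (x.1 ^ 2 + x.2 ^ 2) ≤ 1 + τ / 2}

section
open MeasureTheory ENNReal

lemma l1_sq (w : ℝ × ℝ → ℝ) (hw : ContDiff ℝ 1 w) :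
    eLpNorm (fderiv ℝ (fun x => w x ^ 2)) 1 volume ≤
      2 * (eLpNorm w 2 volume * eLpNorm (fderiv ℝ w) 2 volume) := by
  have hd : fderiv ℝ (fun x => w x ^ 2) = fun x => ((fun x => 2 * w x) • fderiv ℝ w) x := by
    funext x
    have h := ((hw.differentiable one_ne_zero).differentiableAt (x := x)).hasFDerivAt
    have h2 := (h.pow 2).fderiv
    rw [h2]
    ext <;> simp
  have hc : Continuous (fderiv ℝ w) := hw.continuous_fderiv one_ne_zero
  rw [hd]
  refine (eLpNorm_smul_le_mul_eLpNorm (p := 2) (q := 2) hc.aestronglyMeasurable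
    (by have := hw.continuous; fun_prop : Continuous (fun x => 2 * w x)).aestronglyMeasurable).trans ?_
  have : eLpNorm (fun x => 2 * w x) 2 volume = 2 * eLpNorm w 2 volume := by
    have := eLpNorm_const_smul (2:ℝ) w 2 (volume : Measure (ℝ × ℝ))
    rw [show ‖(2:ℝ)‖ₑ = 2 by rw [← ofReal_norm]; norm_num] at this
    simpa [Pi.smul_def] using! this
  rw [this, mul_assoc]

lemma lady : ∃ C : NNReal, ∀ w : ℝ × ℝ → ℝ, ContDiff ℝ 1 w → HasCompactSupport w →
    eLpNorm w 4 volume ^ 2 ≤ C * (eLpNorm w 2 volume * eLpNorm (fderiv ℝ w) 2 volume) := by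
  refine ⟨eLpNormLESNormFDerivOneConst (volume : Measure (ℝ × ℝ)) 2 * 2, fun w hw hs => ?_⟩
  have hq : ContDiff ℝ 1 (fun x => w x ^ 2) := hw.pow 2
  have hqs : HasCompactSupport (fun x => w x ^ 2) := by
    have : (fun x => w x ^ 2) = w * w := by funext x; simp [sq]
    rw [this]; exact hs.mul_right
  have hfr : Module.finrank ℝ (ℝ × ℝ) = 2 := by simp
  have hp : NNReal.HolderConjugate (Module.finrank ℝ (ℝ × ℝ) : NNReal) 2 := by
    rw [hfr]; push_cast
    exact ⟨by norm_num, by norm_num, by norm_num⟩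
  have h := eLpNorm_le_eLpNorm_fderiv_one (volume : Measure (ℝ × ℝ)) hq hqs hp
  have h4 : eLpNorm (fun x => w x ^ 2) 2 volume = eLpNorm w 4 volume ^ 2 := by
    have := eLpNorm_norm_rpow (p := 2) (μ := volume) w (q := 2) (by norm_num)
    rw [show (2:ℝ≥0∞) * ENNReal.ofReal 2 = 4 by norm_num] at this
    rw [← ENNReal.rpow_two, ← this]
    simp
  have e2 : ((2 : NNReal) : ℝ≥0∞) = 2 := by norm_num
  rw [e2, h4] at h
  refine h.trans ?_
  push_cast
  rw [mul_assoc]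
  gcongr
  exact l1_sq w hw

lemma trace_bd (q : ℝ × ℝ → ℝ) (hq : ContDiff ℝ 1 q) (hs : HasCompactSupport q) (r : ℝ)
    (hr : 0 < r) :
    ENNReal.ofReal r * ∫⁻ θ in Set.Ioo (-Real.pi) Real.pi, ‖q (r * Real.cos θ, r * Real.sin θ)‖ₑ
      ≤ eLpNorm (fderiv ℝ q) 1 volume := by
  have hc : Continuous (fderiv ℝ q) := hq.continuous_fderiv one_ne_zero
  have key : ∀ θ : ℝ, ‖q (r * Real.cos θ, r * Real.sin θ)‖ₑ ≤
      ∫⁻ ρ in Set.Ici r, ‖fderiv ℝ q (ρ * Real.cos θ, ρ * Real.sin θ)‖ₑ := by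
    intro θ
    set ξ : ℝ × ℝ := (Real.cos θ, Real.sin θ) with hξ
    have hξ1 : ‖ξ‖ ≤ 1 := by
      simp only [hξ, Prod.norm_def, Real.norm_eq_abs]
      exact max_le (Real.abs_cos_le_one _) (Real.abs_sin_le_one _)
    have hξ0 : ξ ≠ 0 := by
      intro h
      have h1 : Real.cos θ = 0 := congrArg Prod.fst h
      have h2 : Real.sin θ = 0 := congrArg Prod.snd h
      have := Real.sin_sq_add_cos_sq θ
      rw [h1, h2] at this; norm_num at this
    set φ : ℝ → ℝ := fun y => q (-y • ξ) with hφ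
    have hφc : ContDiff ℝ 1 φ := hq.comp (by fun_prop)
    have hφs : HasCompactSupport φ := by
      refine hs.comp_isClosedEmbedding (g := fun y : ℝ => -y • ξ) ?_
      have h1 : Topology.IsClosedEmbedding (fun y : ℝ => y • ξ) := isClosedEmbedding_smul_left hξ0
      exact h1.comp (Homeomorph.neg ℝ).isClosedEmbedding
    have hd : ∀ y, ‖deriv φ y‖ₑ ≤ ‖fderiv ℝ q (-y • ξ)‖ₑ := by
      intro y
      have h1 : HasDerivAt (fun y : ℝ => -y • ξ) (-ξ) y := by
        simpa using! ((hasDerivAt_id y).neg.smul_const ξ)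
      have h2 := ((hq.differentiable one_ne_zero).differentiableAt (x := -y • ξ)).hasFDerivAt
      have h3 := (h2.comp_hasDerivAt y h1).deriv
      change ‖deriv (q ∘ fun y : ℝ => -y • ξ) y‖ₑ ≤ _
      rw [h3]
      refine (ContinuousLinearMap.le_opENorm _ _).trans ?_
      rw [enorm_neg]
      have : ‖ξ‖ₑ ≤ 1 := by
        rw [← ofReal_norm]; exact ENNReal.ofReal_le_one.2 hξ1
      calc _ ≤ ‖fderiv ℝ q (-y • ξ)‖ₑ * 1 := by gcongr
        _ = _ := mul_one _
    have h := HasCompactSupport.enorm_le_lintegral_Ici_deriv hφc hφs (-r)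
    have e1 : φ (-r) = q (r * Real.cos θ, r * Real.sin θ) := by simp [hφ, hξ]
    rw [e1] at h
    refine h.trans ((lintegral_mono hd).trans ?_)
    have := (Measure.measurePreserving_neg (volume : Measure ℝ)).setLIntegral_comp_preimage
      (s := Set.Ici r) measurableSet_Ici
      (f := fun ρ => ‖fderiv ℝ q (ρ • ξ)‖ₑ) (by fun_prop)
    have e3 : (Neg.neg ⁻¹' Set.Ici r) = Set.Iic (-r) := by ext x; simp
    rw [e3] at this
    rw [this]
    simp [hξ]
  have meas : Measurable (fun p : ℝ × ℝ => ‖fderiv ℝ q (p.1 * Real.cos p.2, p.1 * Real.sin p.2)‖ₑ) := by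
    have : Continuous (fun p : ℝ × ℝ => fderiv ℝ q (p.1 * Real.cos p.2, p.1 * Real.sin p.2)) := by
      fun_prop
    exact this.measurable.enorm
  have meas2 : Measurable (fun p : ℝ × ℝ => ENNReal.ofReal p.1 •
      ‖fderiv ℝ q (polarCoord.symm p)‖ₑ) :=
    (ENNReal.measurable_ofReal.comp measurable_fst).mul meas
  calc ENNReal.ofReal r * ∫⁻ θ in Set.Ioo (-Real.pi) Real.pi, ‖q (r * Real.cos θ, r * Real.sin θ)‖ₑ
      ≤ ENNReal.ofReal r * ∫⁻ θ in Set.Ioo (-Real.pi) Real.pi,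
        ∫⁻ ρ in Set.Ici r, ‖fderiv ℝ q (ρ * Real.cos θ, ρ * Real.sin θ)‖ₑ := by
        gcongr with θ; exact key θ
    _ = ∫⁻ θ in Set.Ioo (-Real.pi) Real.pi,
        ENNReal.ofReal r * ∫⁻ ρ in Set.Ici r, ‖fderiv ℝ q (ρ * Real.cos θ, ρ * Real.sin θ)‖ₑ := by
        rw [lintegral_const_mul' _ _ ENNReal.ofReal_ne_top]
    _ ≤ ∫⁻ θ in Set.Ioo (-Real.pi) Real.pi, ∫⁻ ρ in Set.Ioi 0,
        ENNReal.ofReal ρ * ‖fderiv ℝ q (ρ * Real.cos θ, ρ * Real.sin θ)‖ₑ := by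
        refine lintegral_mono fun θ => ?_
        rw [← lintegral_const_mul' _ _ ENNReal.ofReal_ne_top]
        refine (setLIntegral_mono' measurableSet_Ici (fun ρ (hρ : r ≤ ρ) => ?_)).trans
          (lintegral_mono_set (fun ρ (hρ : r ≤ ρ) => lt_of_lt_of_le hr hρ))
        gcongr
    _ = eLpNorm (fderiv ℝ q) 1 volume := by
        rw [eLpNorm_one_eq_lintegral_enorm, ← lintegral_comp_polarCoord_symm]
        have : polarCoord.target = Set.Ioi (0:ℝ) ×ˢ Set.Ioo (-Real.pi) Real.pi := rfl
        rw [this, Measure.volume_eq_prod, ← Measure.prod_restrict,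
          lintegral_prod_symm' _ meas2]
        rfl
end

section
open MeasureTheory ENNReal

lemma circ_norm (g : ℝ × ℝ → ℝ) (hg : Measurable g) (B : ℝ) (hB : ∀ x, |g x| ≤ B) (r : ℝ) :
    (∫⁻ θ in Set.Ioo (-Real.pi) Real.pi, ‖g (r * Real.cos θ, r * Real.sin θ)‖ₑ ^ (2:ℝ)) ^ (1/(2:ℝ))
    = ENNReal.ofReal (Real.sqrt
      (∫ θ in Set.Ioc (0:ℝ) (2 * Real.pi), (g (r * Real.cos θ, r * Real.sin θ)) ^ 2)) := by
  set φ : ℝ → ℝ := fun θ => (g (r * Real.cos θ, r * Real.sin θ)) ^ 2 with hφ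
  have hφm : Measurable φ := by
    have : Measurable (fun θ : ℝ => (r * Real.cos θ, r * Real.sin θ)) := by fun_prop
    exact (hg.comp this).pow_const 2
  have hφB : ∀ θ, ‖φ θ‖ ≤ B ^ 2 := fun θ => by
    simp only [hφ, norm_pow, Real.norm_eq_abs]
    exact pow_le_pow_left₀ (abs_nonneg _) (hB _) 2
  have hper : Function.Periodic φ (2 * Real.pi) := fun θ => by simp [hφ]
  have e1 : ∫ θ in Set.Ioc (0:ℝ) (2 * Real.pi), φ θ = ∫ θ in Set.Ioc (-Real.pi) Real.pi, φ θ := by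
    rw [← intervalIntegral.integral_of_le (by positivity),
      ← intervalIntegral.integral_of_le (by linarith [Real.pi_pos])]
    have := hper.intervalIntegral_add_eq 0 (-Real.pi)
    rw [zero_add, show -Real.pi + 2 * Real.pi = Real.pi by ring] at this
    exact this
  have hint : Integrable φ (volume.restrict (Set.Ioc (-Real.pi) Real.pi)) := by
    refine Integrable.of_bound hφm.aestronglyMeasurable (B ^ 2) (.of_forall hφB)
  rw [e1, Real.sqrt_eq_rpow, ← ENNReal.ofReal_rpow_of_nonneg
    (integral_nonneg fun θ => by simp only [hφ]; positivity) (by norm_num),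
    ofReal_integral_eq_lintegral_ofReal hint (.of_forall fun θ => by simp only [hφ]; positivity),
    setLIntegral_congr Ioo_ae_eq_Ioc]
  congr 1
  refine lintegral_congr fun θ => ?_
  simp only [hφ]
  rw [← ofReal_norm, ENNReal.ofReal_rpow_of_nonneg (norm_nonneg _) (by norm_num)]
  simp

lemma L12_int (g : ℝ × ℝ → ℝ) (hg : Measurable g) (B : ℝ) (hB : ∀ x, |g x| ≤ B) (ρ : ℝ)
    (hρ : ∀ r, ρ < r → ∀ θ, g (r * Real.cos θ, r * Real.sin θ) = 0) :
    Integrable (fun r => Real.sqrt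
      (∫ θ in Set.Ioc (0:ℝ) (2 * Real.pi), (g (r * Real.cos θ, r * Real.sin θ)) ^ 2) * r)
      (volume.restrict (Set.Ioi 0)) := by
  have hB0 : 0 ≤ B := (abs_nonneg _).trans (hB 0)
  set H : ℝ → ℝ := fun r => Real.sqrt
      (∫ θ in Set.Ioc (0:ℝ) (2 * Real.pi), (g (r * Real.cos θ, r * Real.sin θ)) ^ 2) * r with hH
  have hm : Measurable H := by
    have h1 : Measurable (fun p : ℝ × ℝ => (g (p.1 * Real.cos p.2, p.1 * Real.sin p.2)) ^ 2) := by
      have : Measurable (fun p : ℝ × ℝ => (p.1 * Real.cos p.2, p.1 * Real.sin p.2)) := by fun_prop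
      exact (hg.comp this).pow_const 2
    have h2 := (h1.stronglyMeasurable.integral_prod_right'
      (ν := volume.restrict (Set.Ioc (0:ℝ) (2 * Real.pi)))).measurable
    exact (Real.continuous_sqrt.measurable.comp h2).mul measurable_id
  have hz : ∀ r, ρ < r → H r = 0 := fun r hr => by simp [hH, hρ r hr]
  have hsup : IntegrableOn H (Set.Ioc 0 ρ) := by
    have hb : ∀ r ∈ Set.Ioc 0 ρ, ‖H r‖ ≤ Real.sqrt (B ^ 2 * (2 * Real.pi)) * ρ := by
      intro r hr
      simp only [hH, norm_mul, Real.norm_eq_abs, abs_of_nonneg (Real.sqrt_nonneg _), abs_of_pos hr.1]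
      refine mul_le_mul (Real.sqrt_le_sqrt ?_) hr.2 hr.1.le (Real.sqrt_nonneg _)
      · have := norm_setIntegral_le_of_norm_le_const (μ := volume) (s := Set.Ioc (0:ℝ) (2 * Real.pi))
          (f := fun θ => (g (r * Real.cos θ, r * Real.sin θ)) ^ 2) (C := B ^ 2) measure_Ioc_lt_top
          (fun θ _ => by
            simp only [norm_pow, Real.norm_eq_abs]
            exact pow_le_pow_left₀ (abs_nonneg _) (hB _) 2)
        refine (le_abs_self _).trans (this.trans_eq ?_)
        simp [Measure.real, Real.pi_pos.le]
    exact Measure.integrableOn_of_bounded (by simp) hm.aestronglyMeasurable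
      ((ae_restrict_iff' measurableSet_Ioc).2 (.of_forall hb))
  refine IntegrableOn.of_forall_sdiff_eq_zero hsup measurableSet_Ioi ?_
  intro r hr
  apply hz
  by_contra h
  exact hr.2 ⟨hr.1, not_lt.1 h⟩

lemma L12_pair (g : ℝ × ℝ → ℝ) (hg : Measurable g) (B : ℝ) (hB : ∀ x, |g x| ≤ B) (ρ : ℝ)
    (hρ : ∀ r, ρ < r → ∀ θ, g (r * Real.cos θ, r * Real.sin θ) = 0) (r₀ : ℝ) (hr₀ : 0 < r₀)
    (hz : ∀ r, 0 < r → r ≤ r₀ → ∀ θ, g (r * Real.cos θ, r * Real.sin θ) = 0)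
    (w : ℝ × ℝ → ℝ) (hw : ContDiff ℝ 1 w) (hws : HasCompactSupport w) (D : ℝ) (hD : 0 ≤ D)
    (hwD : eLpNorm w 2 volume * eLpNorm (fderiv ℝ w) 2 volume ≤ ENNReal.ofReal (D ^ 2)) :
    ∫⁻ x, ‖g x‖ₑ * ‖w x‖ₑ ≤ ENNReal.ofReal (Real.sqrt (2 * D ^ 2 / r₀) * L12norm g) := by
  have hwc := hw.continuous
  have hq : ContDiff ℝ 1 (fun x => w x ^ 2) := hw.pow 2
  have hqs : HasCompactSupport (fun x => w x ^ 2) := by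
    have : (fun x => w x ^ 2) = w * w := by funext x; simp [sq]
    rw [this]; exact hws.mul_right
  have mp : Measurable (fun p : ℝ × ℝ => (p.1 * Real.cos p.2, p.1 * Real.sin p.2)) := by fun_prop
  have hwcirc : ∀ r, r₀ < r → (∫⁻ θ in Set.Ioo (-Real.pi) Real.pi,
      ‖w (r * Real.cos θ, r * Real.sin θ)‖ₑ ^ (2:ℝ)) ^ (1/(2:ℝ)) ≤
      ENNReal.ofReal (Real.sqrt (2 * D ^ 2 / r₀)) := by
    intro r hr
    have hr0 : 0 < r := hr₀.trans hr
    have h1 := (trace_bd _ hq hqs r hr0).trans (l1_sq w hw)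
    have h2 : ENNReal.ofReal r₀ * ∫⁻ θ in Set.Ioo (-Real.pi) Real.pi,
        ‖w (r * Real.cos θ, r * Real.sin θ)‖ₑ ^ (2:ℝ) ≤ ENNReal.ofReal (2 * D ^ 2) := by
      calc _ ≤ ENNReal.ofReal r * ∫⁻ θ in Set.Ioo (-Real.pi) Real.pi,
          ‖w (r * Real.cos θ, r * Real.sin θ) ^ 2‖ₑ := by
            simp only [enorm_pow, ENNReal.rpow_two]
            gcongr
        _ ≤ _ := h1
        _ ≤ 2 * ENNReal.ofReal (D ^ 2) := by gcongr
        _ = _ := by rw [ENNReal.ofReal_mul (by norm_num)]; norm_num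
    have h3 : ∫⁻ θ in Set.Ioo (-Real.pi) Real.pi,
        ‖w (r * Real.cos θ, r * Real.sin θ)‖ₑ ^ (2:ℝ) ≤ ENNReal.ofReal (2 * D ^ 2 / r₀) := by
      rw [ENNReal.ofReal_div_of_pos hr₀]
      rw [ENNReal.le_div_iff_mul_le (Or.inl (by simpa using hr₀)) (Or.inl ENNReal.ofReal_ne_top),
        mul_comm]
      exact h2
    rw [Real.sqrt_eq_rpow, ← ENNReal.ofReal_rpow_of_nonneg (by positivity) (by norm_num)]
    gcongr
  rw [← lintegral_comp_polarCoord_symm]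
  have htar : polarCoord.target = Set.Ioi (0:ℝ) ×ˢ Set.Ioo (-Real.pi) Real.pi := rfl
  have meas2 : Measurable (fun p : ℝ × ℝ => ENNReal.ofReal p.1 •
      (‖g (polarCoord.symm p)‖ₑ * ‖w (polarCoord.symm p)‖ₑ)) :=
    (ENNReal.measurable_ofReal.comp measurable_fst).mul
      ((hg.comp mp).enorm.mul (hwc.measurable.comp mp).enorm)
  rw [htar, Measure.volume_eq_prod, ← Measure.prod_restrict, lintegral_prod _ meas2.aemeasurable]
  have hL0 : 0 ≤ᵐ[volume.restrict (Set.Ioi (0:ℝ))] (fun r => Real.sqrt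
      (∫ θ in Set.Ioc (0:ℝ) (2 * Real.pi), (g (r * Real.cos θ, r * Real.sin θ)) ^ 2) * r) :=
    (ae_restrict_iff' measurableSet_Ioi).2 (.of_forall fun r hr =>
      mul_nonneg (Real.sqrt_nonneg _) (le_of_lt hr))
  rw [ENNReal.ofReal_mul (Real.sqrt_nonneg _), L12norm,
    ofReal_integral_eq_lintegral_ofReal (L12_int g hg B hB ρ hρ) hL0,
    ← lintegral_const_mul' _ _ ENNReal.ofReal_ne_top]
  refine setLIntegral_mono' measurableSet_Ioi fun r (hr : 0 < r) => ?_
  change ∫⁻ θ in Set.Ioo (-Real.pi) Real.pi, ENNReal.ofReal r *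
      (‖g (r * Real.cos θ, r * Real.sin θ)‖ₑ * ‖w (r * Real.cos θ, r * Real.sin θ)‖ₑ) ≤ _
  rcases le_or_gt r r₀ with h | h
  · simp [hz r hr h]
  have mr : Measurable (fun θ : ℝ => (r * Real.cos θ, r * Real.sin θ)) := by fun_prop
  rw [lintegral_const_mul' _ _ ENNReal.ofReal_ne_top]
  have hol := ENNReal.lintegral_mul_le_Lp_mul_Lq (volume.restrict (Set.Ioo (-Real.pi) Real.pi))
    Real.HolderConjugate.two_two
    (hg.comp mr).enorm.aemeasurable (hwc.measurable.comp mr).enorm.aemeasurable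
  calc _ ≤ ENNReal.ofReal r * _ :=  mul_le_mul' le_rfl hol
    _ ≤ ENNReal.ofReal r * (ENNReal.ofReal (Real.sqrt
      (∫ θ in Set.Ioc (0:ℝ) (2 * Real.pi), (g (r * Real.cos θ, r * Real.sin θ)) ^ 2)) *
        ENNReal.ofReal (Real.sqrt (2 * D ^ 2 / r₀))) := by
        exact mul_le_mul' le_rfl (mul_le_mul' (circ_norm g hg B hB r).le (hwcirc r h))
    _ = _ := by
        rw [ENNReal.ofReal_mul (Real.sqrt_nonneg _)]; ring

/-- The norm of the source at time `σ`. -/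
def Nrm (f : Pt → ℝ) (τ : ℝ) : ℝ≥0∞ :=
  eLpNorm ((chi1Set τ).indicator fun x : ℝ × ℝ => f (τ, x)) (4 / 3) volume
    + ENNReal.ofReal ((1 + τ) ^ (-(1:ℝ) / 2)
        * L12norm (((chi1Set τ)ᶜ).indicator fun x : ℝ × ℝ => f (τ, x)))

lemma chi1_meas (τ : ℝ) : MeasurableSet (chi1Set τ) := by
  have : IsClosed (chi1Set τ) := isClosed_le (by fun_prop) (by fun_prop)
  exact this.measurableSet

lemma hold43 (g w : ℝ × ℝ → ℝ) (hg : Measurable g) (hw : Continuous w) :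
    ∫⁻ x, ‖g x‖ₑ * ‖w x‖ₑ ≤ eLpNorm g (4/3) volume * eLpNorm w 4 volume := by
  have : ENNReal.HolderTriple (4/3) 4 1 := ⟨by
    rw [ENNReal.inv_div (by simp) (by simp), inv_one,
      ← ENNReal.toReal_eq_toReal_iff' (by finiteness) (by simp)]
    rw [ENNReal.toReal_add (by finiteness) (by simp)]
    simp; norm_num⟩
  have := eLpNorm_smul_le_mul_eLpNorm (p := 4/3) (q := 4) (r := 1) (μ := volume)
    hw.aestronglyMeasurable hg.aestronglyMeasurable
  rw [eLpNorm_one_eq_lintegral_enorm] at this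
  simpa using! this

lemma pairing : ∃ C > (0:ℝ), ∀ w : ℝ × ℝ → ℝ, ContDiff ℝ 1 w → HasCompactSupport w →
    ∀ D : ℝ, 0 ≤ D →
    eLpNorm w 2 volume * eLpNorm (fderiv ℝ w) 2 volume ≤ ENNReal.ofReal (D ^ 2) →
    (∀ g : ℝ × ℝ → ℝ, Measurable g →
      ∫⁻ x, ‖g x‖ₑ * ‖w x‖ₑ ≤ ENNReal.ofReal (C * D) * eLpNorm g (4/3) volume) ∧
    (∀ f : Pt → ℝ, Continuous f → ∀ τ : ℝ, 0 ≤ τ → HasCompactSupport (fun x : ℝ × ℝ => f (τ, x)) →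
      ∫⁻ x, ‖f (τ, x)‖ₑ * ‖w x‖ₑ ≤ ENNReal.ofReal (C * D) * Nrm f τ) := by
  obtain ⟨C₀, hC₀⟩ := lady
  refine ⟨Real.sqrt C₀ + 2, by positivity, fun w hw hws D hD hwD => ?_⟩
  have h4 : eLpNorm w 4 volume ≤ ENNReal.ofReal ((Real.sqrt C₀ + 2) * D) := by
    have h1 : eLpNorm w 4 volume ^ 2 ≤ ENNReal.ofReal (Real.sqrt C₀ * D) ^ 2 := by
      refine (hC₀ w hw hws).trans ?_
      rw [← ENNReal.ofReal_pow (by positivity), mul_pow, Real.sq_sqrt (by positivity),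
        ENNReal.ofReal_mul (by positivity), ENNReal.ofReal_coe_nnreal]
      gcongr
    have h2 : eLpNorm w 4 volume ≤ ENNReal.ofReal (Real.sqrt C₀ * D) :=
      (ENNReal.pow_le_pow_left_iff two_ne_zero).1 h1
    refine h2.trans (ENNReal.ofReal_le_ofReal ?_)
    nlinarith
  have A : ∀ g : ℝ × ℝ → ℝ, Measurable g →
      ∫⁻ x, ‖g x‖ₑ * ‖w x‖ₑ ≤
        ENNReal.ofReal ((Real.sqrt C₀ + 2) * D) * eLpNorm g (4/3) volume := by
    intro g hg
    refine (hold43 g w hg hw.continuous).trans ?_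
    rw [mul_comm]
    gcongr
  refine ⟨A, fun f hf τ hτ hfs => ?_⟩
  set g : ℝ × ℝ → ℝ := fun x => f (τ, x) with hg
  have hgc : Continuous g := by fun_prop
  obtain ⟨B, hB⟩ := hgc.bounded_above_of_compact_support hfs
  obtain ⟨ρ, hρ⟩ := hfs.isCompact.isBounded.subset_closedBall 0
  have hm1 := hgc.measurable.indicator (chi1_meas τ)
  have hm2 := hgc.measurable.indicator (chi1_meas τ).compl
  have split : ∀ x, ‖g x‖ₑ * ‖w x‖ₑ = ‖(chi1Set τ).indicator g x‖ₑ * ‖w x‖ₑ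
      + ‖(chi1Set τ)ᶜ.indicator g x‖ₑ * ‖w x‖ₑ := by
    intro x
    by_cases hx : x ∈ chi1Set τ <;> simp [hx]
  have hnorm : ∀ r θ : ℝ, (r * Real.cos θ) ^ 2 + (r * Real.sin θ) ^ 2 = r ^ 2 := fun r θ => by
    have := Real.sin_sq_add_cos_sq θ
    linear_combination r ^ 2 * this
  have hB0 : 0 ≤ B := (norm_nonneg _).trans (hB 0)
  have P := L12_pair ((chi1Set τ)ᶜ.indicator g) hm2 B (fun x => by
      by_cases hx : x ∈ chi1Set τ
      · simp [hx, hB0]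
      · simpa [hx] using hB x) (2 * |ρ|) (fun r hr θ => by
      have : g (r * Real.cos θ, r * Real.sin θ) = 0 := by
        by_contra hne
        have hmem := hρ (subset_tsupport _ (Function.mem_support.2 hne))
        rw [mem_closedBall_zero_iff, Prod.norm_def] at hmem
        have h1 := (le_max_left _ _).trans (hmem.trans (le_abs_self ρ))
        have h2 := (le_max_right _ _).trans (hmem.trans (le_abs_self ρ))
        simp only [Real.norm_eq_abs] at h1 h2
        have h3 := sq_le_sq' (abs_le.1 h1).1 (abs_le.1 h1).2
        have h4 := sq_le_sq' (abs_le.1 h2).1 (abs_le.1 h2).2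
        have := hnorm r θ
        nlinarith [abs_nonneg ρ]
      simp [this]) (1 + τ / 2) (by positivity) (fun r hr hr2 θ => by
      have : (r * Real.cos θ, r * Real.sin θ) ∈ chi1Set τ := by
        simp only [chi1Set, Set.mem_ofPred_eq]
        rw [hnorm, Real.sqrt_sq hr.le]; exact hr2
      simp [this]) w hw hws D hD hwD
  have hm3 : Measurable (fun x => ‖(chi1Set τ).indicator g x‖ₑ * ‖w x‖ₑ) :=
    hm1.enorm.mul hw.continuous.measurable.enorm
  rw [lintegral_congr split, lintegral_add_left hm3, Nrm, mul_add]
  refine add_le_add (A _ hm1) (P.trans ?_)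
  rw [← ENNReal.ofReal_mul (by positivity)]
  apply ENNReal.ofReal_le_ofReal
  rw [← mul_assoc]
  have hL : 0 ≤ L12norm ((chi1Set τ)ᶜ.indicator g) :=
    setIntegral_nonneg measurableSet_Ioi fun r hr => mul_nonneg (Real.sqrt_nonneg _) (le_of_lt hr)
  refine mul_le_mul_of_nonneg_right ?_ hL
  have e : (1 + τ) ^ (-(1:ℝ)/2) = (Real.sqrt (1 + τ))⁻¹ := by
    rw [neg_div, Real.rpow_neg (by positivity), Real.sqrt_eq_rpow]
  rw [e]
  calc Real.sqrt (2 * D ^ 2 / (1 + τ / 2)) ≤ Real.sqrt ((2 * D) ^ 2 / (1 + τ)) := by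
        apply Real.sqrt_le_sqrt
        rw [div_le_div_iff₀ (by positivity) (by positivity)]
        nlinarith [sq_nonneg D, mul_nonneg (sq_nonneg D) hτ]
    _ = 2 * D * (Real.sqrt (1 + τ))⁻¹ := by
        rw [Real.sqrt_div (sq_nonneg _), Real.sqrt_sq (by positivity)]; rfl
    _ ≤ _ := by
        gcongr
        linarith [Real.sqrt_nonneg (C₀:ℝ)]
end

section
open MeasureTheory ENNReal Topology

/-- Time primitive. -/
def prim (g : Pt → ℝ) (p : Pt) : ℝ := ∫ s in (0:ℝ)..p.1, g (s, p.2)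

lemma prim_cont (g : Pt → ℝ) (hg : Continuous g) : Continuous (prim g) := by
  unfold prim
  exact intervalIntegral.continuous_parametric_intervalIntegral_of_continuous
    (f := fun (p : Pt) (s : ℝ) => g (s, p.2)) (by simp only [Function.uncurry_def]; fun_prop)
    continuous_fst

lemma prim_dt (g : Pt → ℝ) (hg : Continuous g) (t : ℝ) (x : ℝ × ℝ) :
    HasDerivAt (fun t => prim g (t, x)) (g (t, x)) t := by
  have hc : Continuous (fun s => g (s, x)) := by fun_prop
  exact intervalIntegral.integral_hasDerivAt_right (hc.intervalIntegrable _ _)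
    (hc.stronglyMeasurableAtFilter _ _) hc.continuousAt

lemma fd_split (g : Pt → ℝ) (p : Pt) (x : ℝ × ℝ) :
    fderiv ℝ g p (0, x) = x.1 * vd1 g p + x.2 * vd2 g p := by
  have : ((0:ℝ), x) = x.1 • ((0:ℝ), (1:ℝ), (0:ℝ)) + x.2 • ((0:ℝ), (0:ℝ), (1:ℝ)) := by
    ext <;> simp
  rw [this, map_add, map_smul, map_smul]
  rfl

/-- The linear form with given components. -/
def lf (a b : ℝ) : ℝ × ℝ →L[ℝ] ℝ := a • ContinuousLinearMap.fst ℝ ℝ ℝ + b • ContinuousLinearMap.snd ℝ ℝ ℝ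

lemma lf_apply (a b : ℝ) (x : ℝ × ℝ) : lf a b x = a * x.1 + b * x.2 := by simp [lf]

lemma lf_cont {X : Type*} [TopologicalSpace X] (a b : X → ℝ) (ha : Continuous a) (hb : Continuous b) :
    Continuous (fun x => lf (a x) (b x)) := by
  unfold lf; fun_prop

lemma lf_norm (a b : ℝ) : ‖lf a b‖ ≤ |a| + |b| := by
  refine ContinuousLinearMap.opNorm_le_bound _ (by positivity) fun x => ?_
  rw [lf_apply, Real.norm_eq_abs]
  have h1 : |x.1| ≤ ‖x‖ := norm_fst_le x
  have h2 : |x.2| ≤ ‖x‖ := norm_snd_le x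
  calc |a * x.1 + b * x.2| ≤ |a| * |x.1| + |b| * |x.2| := by
        rw [← abs_mul, ← abs_mul]; exact abs_add_le _ _
    _ ≤ |a| * ‖x‖ + |b| * ‖x‖ := by gcongr
    _ = _ := by ring

lemma space_fd (g : Pt → ℝ) (hg : ContDiff ℝ 1 g) (t : ℝ) (x : ℝ × ℝ) :
    HasFDerivAt (fun x => g (t, x)) (lf (vd1 g (t, x)) (vd2 g (t, x))) x := by
  have h := ((hg.differentiable one_ne_zero).differentiableAt (x := (t, x))).hasFDerivAt
  have h1 : HasFDerivAt (fun x : ℝ × ℝ => ((t, x) : Pt)) (ContinuousLinearMap.inr ℝ ℝ (ℝ × ℝ)) x :=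
    hasFDerivAt_prodMk_right t x
  have h2 := h.comp x h1
  convert! h2 using 1
  apply ContinuousLinearMap.ext
  intro y
  rw [lf_apply, ContinuousLinearMap.comp_apply, ContinuousLinearMap.inr_apply, fd_split]
  ring

lemma time_d (g : Pt → ℝ) (hg : ContDiff ℝ 1 g) (t : ℝ) (x : ℝ × ℝ) :
    HasDerivAt (fun t => g (t, x)) (vdt g (t, x)) t := by
  have h := ((hg.differentiable one_ne_zero).differentiableAt (x := (t, x))).hasFDerivAt
  have h1 : HasDerivAt (fun t : ℝ => ((t, x) : Pt)) ((1:ℝ), (0:ℝ), (0:ℝ)) t :=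
    (hasDerivAt_id t).prodMk (hasDerivAt_const t x)
  exact h.comp_hasDerivAt t h1

lemma vd_cont (g : Pt → ℝ) (hg : ContDiff ℝ 1 g) :
    Continuous (vdt g) ∧ Continuous (vd1 g) ∧ Continuous (vd2 g) := by
  have := hg.continuous_fderiv one_ne_zero
  unfold vdt vd1 vd2
  refine ⟨?_, ?_, ?_⟩ <;> fun_prop

lemma vd_smooth (g : Pt → ℝ) (hg : ContDiff ℝ (⊤ : ℕ∞) g) :
    ContDiff ℝ (⊤ : ℕ∞) (vdt g) ∧ ContDiff ℝ (⊤ : ℕ∞) (vd1 g) ∧ ContDiff ℝ (⊤ : ℕ∞) (vd2 g) := by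
  have := hg.fderiv_right (m := (⊤ : ℕ∞)) (by simp)
  unfold vdt vd1 vd2
  refine ⟨?_, ?_, ?_⟩ <;> exact this.clm_apply contDiff_const

lemma prim_fd (g : Pt → ℝ) (hg : ContDiff ℝ 1 g) (t : ℝ) (x : ℝ × ℝ) :
    HasFDerivAt (fun x => prim g (t, x)) (lf (prim (vd1 g) (t, x)) (prim (vd2 g) (t, x))) x := by
  obtain ⟨-, h1, h2⟩ := vd_cont g hg
  have hgc := hg.continuous
  have hDc : Continuous (fun p : Pt => lf (vd1 g p) (vd2 g p)) := lf_cont _ _ h1 h2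
  obtain ⟨C, hC⟩ := (((isCompact_uIcc (a := (0:ℝ)) (b := t)).prod
    (isCompact_closedBall x 1)).exists_bound_of_continuousOn hDc.continuousOn)
  have h := intervalIntegral.hasFDerivAt_integral_of_dominated_of_fderiv_le (𝕜 := ℝ)
    (μ := volume) (a := 0) (b := t)
    (F := fun (y : ℝ × ℝ) s => g (s, y)) (F' := fun y s => lf (vd1 g (s, y)) (vd2 g (s, y)))
    (x₀ := x) (s := Metric.closedBall x 1) (bound := fun _ => C)
    (Metric.closedBall_mem_nhds x one_pos)
    (.of_forall fun y => (by fun_prop : Continuous fun s => g (s, y)).aestronglyMeasurable)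
    ((by fun_prop : Continuous fun s => g (s, x)).intervalIntegrable _ _)
    ((hDc.comp (by fun_prop : Continuous fun s : ℝ => ((s, x) : Pt))).aestronglyMeasurable)
    (.of_forall fun s hs y hy => hC (s, y) ⟨Set.uIoc_subset_uIcc hs, hy⟩)
    (by simp)
    (.of_forall fun s hs y hy => space_fd g hg s y)
  convert! h using 1
  apply ContinuousLinearMap.ext
  intro y
  have hDx : Continuous fun s : ℝ => lf (vd1 g (s, x)) (vd2 g (s, x)) :=
    hDc.comp (by fun_prop : Continuous fun s : ℝ => ((s, x) : Pt))
  rw [ContinuousLinearMap.intervalIntegral_apply (hDx.intervalIntegrable _ _)]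
  simp only [lf_apply, prim]
  rw [intervalIntegral.integral_add, intervalIntegral.integral_mul_const,
    intervalIntegral.integral_mul_const]
  · exact Continuous.intervalIntegrable (by fun_prop) _ _
  · exact Continuous.intervalIntegrable (by fun_prop) _ _

/-- Japanese bracket. -/
def jap (x : ℝ × ℝ) : ℝ := Real.sqrt (1 + x.1 ^ 2 + x.2 ^ 2)

lemma jap_pos (x : ℝ × ℝ) : 0 < jap x := Real.sqrt_pos.2 (by positivity)
lemma jap_sq (x : ℝ × ℝ) : jap x ^ 2 = 1 + x.1 ^ 2 + x.2 ^ 2 := Real.sq_sqrt (by positivity)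
lemma jap_cont : Continuous jap := by unfold jap; fun_prop

lemma jap_ge (x : ℝ × ℝ) : ‖x‖ ≤ jap x := by
  rw [Prod.norm_def]
  refine max_le ?_ ?_
  · exact Real.abs_le_sqrt (by nlinarith [sq_nonneg x.2])
  · exact Real.abs_le_sqrt (by nlinarith [sq_nonneg x.1])

/-- The components of the gradient of the bracket. -/
def j1 (p : Pt) : ℝ := p.2.1 / jap p.2
def j2 (p : Pt) : ℝ := p.2.2 / jap p.2

lemma j_cont : Continuous j1 ∧ Continuous j2 := by
  have h : Continuous (fun p : Pt => jap p.2) := jap_cont.comp continuous_snd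
  constructor
  · exact (by fun_prop : Continuous fun p : Pt => p.2.1).div h (fun p => (jap_pos _).ne')
  · exact (by fun_prop : Continuous fun p : Pt => p.2.2).div h (fun p => (jap_pos _).ne')

lemma j_le (p : Pt) : j1 p ^ 2 + j2 p ^ 2 ≤ 1 := by
  unfold j1 j2
  rw [div_pow, div_pow, ← add_div, div_le_one (pow_pos (jap_pos _) 2), jap_sq]
  linarith

lemma jap_fd (t : ℝ) (x : ℝ × ℝ) : HasFDerivAt jap (lf (j1 (t, x)) (j2 (t, x))) x := by
  have h1 : HasFDerivAt (fun x : ℝ × ℝ => 1 + x.1 ^ 2 + x.2 ^ 2) (lf (2 * x.1) (2 * x.2)) x := by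
    have a : HasFDerivAt (fun x : ℝ × ℝ => x.1) (ContinuousLinearMap.fst ℝ ℝ ℝ) x := hasFDerivAt_fst
    have b : HasFDerivAt (fun x : ℝ × ℝ => x.2) (ContinuousLinearMap.snd ℝ ℝ ℝ) x := hasFDerivAt_snd
    convert! ((a.pow 2).const_add 1).add (b.pow 2) using 1
    apply ContinuousLinearMap.ext; intro y
    simp [lf_apply]
  have h2 := (Real.hasDerivAt_sqrt (x := 1 + x.1 ^ 2 + x.2 ^ 2) (by positivity)).comp_hasFDerivAt x h1
  convert! h2 using 1
  apply ContinuousLinearMap.ext; intro y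
  have hj : Real.sqrt (1 + x.1 ^ 2 + x.2 ^ 2) = jap x := rfl
  have := (jap_pos x).ne'
  simp only [lf_apply, j1, j2, hj, smul_apply, smul_eq_mul]
  field_simp

lemma max_pow (n : ℕ) (z : ℝ) :
    HasDerivAt (fun z : ℝ => (max 0 z) ^ (n + 2)) ((n + 2) * (max 0 z) ^ (n + 1)) z := by
  rcases lt_trichotomy z 0 with h | h | h
  · rw [max_eq_left h.le]
    have : HasDerivAt (fun _ : ℝ => (0:ℝ)) 0 z := hasDerivAt_const _ _
    simp only [ne_eq, Nat.add_eq_zero_iff, one_ne_zero, and_false, not_false_eq_true, zero_pow,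
      mul_zero]
    refine this.congr_of_eventuallyEq ?_
    filter_upwards [gt_mem_nhds h] with y hy
    rw [max_eq_left (le_of_lt hy)]; simp
  · subst h
    have hO : (fun z : ℝ => (max 0 z) ^ (n + 2)) =O[𝓝 0] fun z => ‖z - 0‖ ^ (n + 2) := by
      refine Asymptotics.IsBigO.of_bound 1 (.of_forall fun y => ?_)
      rw [one_mul, sub_zero, norm_pow, norm_pow, norm_norm]
      refine pow_le_pow_left₀ (norm_nonneg _) ?_ _
      rw [Real.norm_eq_abs, Real.norm_eq_abs, abs_of_nonneg (le_max_left _ _)]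
      exact max_le (abs_nonneg _) (le_abs_self _)
    have := (hO.hasFDerivAt (𝕜 := ℝ) (by omega)).hasDerivAt
    simpa using! this
  · have h2 := hasDerivAt_pow (n + 2) z
    rw [max_eq_right h.le]
    have h3 : HasDerivAt (fun z : ℝ => z ^ (n + 2)) ((n + 2) * z ^ (n + 1)) z := by
      convert! h2 using 1; push_cast; rfl
    refine h3.congr_of_eventuallyEq ?_
    filter_upwards [lt_mem_nhds h] with y hy
    rw [max_eq_right (le_of_lt hy)]

/-- The cutoff. -/
def eta (R : ℝ) (p : Pt) : ℝ := max 0 (1 - (p.1 + jap p.2) / R)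

lemma eta_nonneg (R : ℝ) (p : Pt) : 0 ≤ eta R p := le_max_left _ _
lemma eta_cont (R : ℝ) : Continuous (eta R) := by
  have h : Continuous (fun p : Pt => jap p.2) := jap_cont.comp continuous_snd
  unfold eta; fun_prop
lemma eta_le (R : ℝ) (hR : 0 < R) (p : Pt) (hp : 0 ≤ p.1) : eta R p ≤ 1 := by
  refine max_le zero_le_one ?_
  have := jap_pos p.2
  have : 0 ≤ (p.1 + jap p.2) / R := by positivity
  linarith
lemma eta_zero (R : ℝ) (hR : 0 < R) (p : Pt) (hp : 0 ≤ p.1) (hx : R ≤ ‖p.2‖) : eta R p = 0 := by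
  refine max_eq_left ?_
  have := jap_ge p.2
  have : 1 ≤ (p.1 + jap p.2) / R := by rw [le_div_iff₀ hR]; linarith
  linarith
lemma eta_anti (R : ℝ) (hR : 0 < R) (s t : ℝ) (h : s ≤ t) (x : ℝ × ℝ) : eta R (t, x) ≤ eta R (s, x) := by
  unfold eta
  refine max_le_max le_rfl ?_
  simp only
  gcongr

lemma eta_dt (R : ℝ) (n : ℕ) (t : ℝ) (x : ℝ × ℝ) :
    HasDerivAt (fun t => eta R (t, x) ^ (n + 2)) (-((n + 2) * eta R (t, x) ^ (n + 1) / R)) t := by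
  have h : HasDerivAt (fun t : ℝ => 1 - (t + jap x) / R) (-(1 / R)) t :=
    (((hasDerivAt_id t).add_const (jap x)).div_const R).const_sub 1
  have := (max_pow n (1 - (t + jap x) / R)).comp t h
  convert! this using 1
  simp only [eta]
  ring_nf

lemma eta_fd (R : ℝ) (n : ℕ) (t : ℝ) (x : ℝ × ℝ) :
    HasFDerivAt (fun x => eta R (t, x) ^ (n + 2))
      (lf (-((n + 2) * eta R (t, x) ^ (n + 1) / R) * j1 (t, x))
        (-((n + 2) * eta R (t, x) ^ (n + 1) / R) * j2 (t, x))) x := by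
  have h : HasFDerivAt (fun x : ℝ × ℝ => 1 - (t + jap x) * R⁻¹) (-(R⁻¹ • lf (j1 (t, x)) (j2 (t, x)))) x :=
    (((jap_fd t x).const_add t).mul_const R⁻¹).const_sub 1
  have := (max_pow n (1 - (t + jap x) * R⁻¹)).comp_hasFDerivAt x h
  convert! this using 1
  apply ContinuousLinearMap.ext; intro y
  simp only [eta, lf_apply, smul_apply, neg_apply, smul_eq_mul]
  ring_nf
end

section
open MeasureTheory ENNReal Topology

/-- The box. -/
def KK (R : ℝ) : Set (ℝ × ℝ) := Set.Icc (-R) R ×ˢ Set.Icc (-R) R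

lemma KK_compact (R : ℝ) : IsCompact (KK R) := isCompact_Icc.prod isCompact_Icc
lemma KK_meas (R : ℝ) : MeasurableSet (KK R) := measurableSet_Icc.prod measurableSet_Icc
lemma KK_notMem (R : ℝ) (x : ℝ × ℝ) (hx : x ∉ KK R) : R ≤ ‖x‖ := by
  by_contra h
  push Not at h
  rw [Prod.norm_def, max_lt_iff, Real.norm_eq_abs, Real.norm_eq_abs, abs_lt, abs_lt] at h
  exact hx ⟨⟨h.1.1.le, h.1.2.le⟩, ⟨h.2.1.le, h.2.2.le⟩⟩

lemma KK_int (R : ℝ) (g : ℝ × ℝ → ℝ) (hg : Continuous g) : IntegrableOn g (KK R) :=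
  hg.continuousOn.integrableOn_compact (KK_compact R)

lemma swapK (R t : ℝ) (F : Pt → ℝ) (hF : Continuous F) (ht : 0 ≤ t) :
    ∫ x in KK R, ∫ s in (0:ℝ)..t, F (s, x) = ∫ s in (0:ℝ)..t, ∫ x in KK R, F (s, x) := by
  simp_rw [intervalIntegral.integral_of_le ht]
  apply integral_integral_swap
  rw [Measure.prod_restrict]
  have : IntegrableOn (fun z : (ℝ × ℝ) × ℝ => F (z.2, z.1)) (KK R ×ˢ Set.Icc 0 t)
      (volume.prod volume) :=
    (by fun_prop : Continuous fun z : (ℝ × ℝ) × ℝ => F (z.2, z.1)).continuousOn.integrableOn_compact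
      ((KK_compact R).prod isCompact_Icc)
  exact this.mono_set (Set.prod_mono le_rfl Set.Ioc_subset_Icc_self)

lemma div1 (R : ℝ) (hR : 0 < R) (k k' : ℝ × ℝ → ℝ) (hk' : Continuous k')
    (hd : ∀ x y, HasDerivAt (fun x => k (x, y)) (k' (x, y)) x)
    (hz : ∀ y, k (R, y) = 0 ∧ k (-R, y) = 0) : ∫ x in KK R, k' x = 0 := by
  have h : ∀ y, ∫ x in Set.Icc (-R) R, k' (x, y) = 0 := by
    intro y
    rw [integral_Icc_eq_integral_Ioc, ← intervalIntegral.integral_of_le (by linarith),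
      intervalIntegral.integral_eq_sub_of_hasDerivAt (fun x _ => hd x y)
        (Continuous.intervalIntegrable (by fun_prop) _ _), (hz y).1, (hz y).2, sub_zero]
  have hi := KK_int R k' hk'
  rw [KK, Measure.volume_eq_prod, ← Measure.prod_restrict, integral_prod_symm _ (by rw [Measure.prod_restrict]; exact hi)]
  simp [h]

lemma div2 (R : ℝ) (hR : 0 < R) (k k' : ℝ × ℝ → ℝ) (hk' : Continuous k')
    (hd : ∀ x y, HasDerivAt (fun y => k (x, y)) (k' (x, y)) y)
    (hz : ∀ x, k (x, R) = 0 ∧ k (x, -R) = 0) : ∫ x in KK R, k' x = 0 := by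
  have h : ∀ x, ∫ y in Set.Icc (-R) R, k' (x, y) = 0 := by
    intro x
    rw [integral_Icc_eq_integral_Ioc, ← intervalIntegral.integral_of_le (by linarith),
      intervalIntegral.integral_eq_sub_of_hasDerivAt (fun y _ => hd x y)
        (Continuous.intervalIntegrable (by fun_prop) _ _), (hz x).1, (hz x).2, sub_zero]
  have hi := KK_int R k' hk'
  rw [KK, Measure.volume_eq_prod, setIntegral_prod _ hi]
  simp [h]

lemma fd_d1 (h : ℝ × ℝ → ℝ) (a b x y : ℝ) (H : HasFDerivAt h (lf a b) (x, y)) :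
    HasDerivAt (fun x => h (x, y)) a x := by
  have h1 : HasDerivAt (fun x : ℝ => (x, y)) ((1:ℝ), (0:ℝ)) x :=
    (hasDerivAt_id x).prodMk (hasDerivAt_const x y)
  have := H.comp_hasDerivAt x h1
  simpa [lf_apply] using! this

lemma fd_d2 (h : ℝ × ℝ → ℝ) (a b x y : ℝ) (H : HasFDerivAt h (lf a b) (x, y)) :
    HasDerivAt (fun y => h (x, y)) b y := by
  have h1 : HasDerivAt (fun y : ℝ => (x, y)) ((0:ℝ), (1:ℝ)) y :=
    (hasDerivAt_const y x).prodMk (hasDerivAt_id y)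
  have := H.comp_hasDerivAt y h1
  simpa [lf_apply] using! this

/-- Energy density. -/
def ee (R : ℝ) (u : Pt → ℝ) (p : Pt) : ℝ :=
  eta R p ^ 4 * (u p ^ 2 + prim (vd1 u) p ^ 2 + prim (vd2 u) p ^ 2)

/-- Cut off primitive. -/
def ww (R : ℝ) (u : Pt → ℝ) (p : Pt) : ℝ := eta R p ^ 3 * prim u p

/-- Source primitive. -/
def GG (u₁ : ℝ × ℝ → ℝ) (f : Pt → ℝ) (p : Pt) : ℝ := u₁ p.2 + prim f p

lemma ww_cont (R : ℝ) (u : Pt → ℝ) (hu : Continuous u) : Continuous (ww R u) :=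
  ((eta_cont R).pow 3).mul (prim_cont u hu)

lemma GG_cont (u₁ : ℝ × ℝ → ℝ) (f : Pt → ℝ) (h1 : Continuous u₁) (hf : Continuous f) :
    Continuous (GG u₁ f) := (h1.comp continuous_snd).add (prim_cont f hf)

lemma ee_cont (R : ℝ) (u : Pt → ℝ) (hu : ContDiff ℝ 1 u) : Continuous (ee R u) := by
  obtain ⟨-, h1, h2⟩ := vd_cont u hu
  have a := prim_cont _ h1
  have b := prim_cont _ h2
  have c := eta_cont R
  have d := hu.continuous
  unfold ee; fun_prop

lemma equ (u₁ : ℝ × ℝ → ℝ) (f u : Pt → ℝ) (hf : Continuous f) (hu : ContDiff ℝ (⊤ : ℕ∞) u)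
    (hbox : ∀ p : Pt, 0 ≤ p.1 → box u p = f p) (hu1 : ∀ x : ℝ × ℝ, vdt u (0, x) = u₁ x)
    (t : ℝ) (ht : 0 ≤ t) (x : ℝ × ℝ) :
    vdt u (t, x) - prim (vd1 (vd1 u)) (t, x) - prim (vd2 (vd2 u)) (t, x) = GG u₁ f (t, x) := by
  obtain ⟨h0, h1, h2⟩ := vd_smooth u hu
  have o : (1 : WithTop ℕ∞) ≤ ((⊤ : ℕ∞) : WithTop ℕ∞) := by exact_mod_cast le_top
  have c0 := (vd_cont _ (h0.of_le o)).1
  have c1 := (vd_cont _ (h1.of_le o)).2.1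
  have c2 := (vd_cont _ (h2.of_le o)).2.2
  have e : vdt u (t, x) - vdt u (0, x) = ∫ s in (0:ℝ)..t, vdt (vdt u) (s, x) := by
    rw [intervalIntegral.integral_eq_sub_of_hasDerivAt
      (fun s _ => time_d _ (h0.of_le o) s x) (Continuous.intervalIntegrable (by fun_prop) _ _)]
  have e2 : ∫ s in (0:ℝ)..t, vdt (vdt u) (s, x) =
      ∫ s in (0:ℝ)..t, (f (s, x) + vd1 (vd1 u) (s, x) + vd2 (vd2 u) (s, x)) := by
    refine intervalIntegral.integral_congr fun s hs => ?_
    rw [Set.uIcc_of_le ht] at hs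
    have := hbox (s, x) hs.1
    simp only [box] at this
    linarith
  rw [intervalIntegral.integral_add (Continuous.intervalIntegrable (by fun_prop) _ _)
    (Continuous.intervalIntegrable (by fun_prop) _ _),
    intervalIntegral.integral_add (Continuous.intervalIntegrable (by fun_prop) _ _)
    (Continuous.intervalIntegrable (by fun_prop) _ _)] at e2
  simp only [GG, prim]
  rw [← hu1 x]
  linarith

lemma energy (u₁ : ℝ × ℝ → ℝ) (f u : Pt → ℝ) (hu₁ : Continuous u₁)
    (hf : Continuous f) (hu : ContDiff ℝ (⊤ : ℕ∞) u)
    (hbox : ∀ p : Pt, 0 ≤ p.1 → box u p = f p) (hu1 : ∀ x : ℝ × ℝ, vdt u (0, x) = u₁ x)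
    (R : ℝ) (hR : 0 < R) (t : ℝ) (ht : 0 ≤ t) :
    ∫ x in KK R, ee R u (t, x) ≤ (∫ x in KK R, ee R u (0, x)) +
      2 * (∫ x in KK R, |ww R u (t, x)| * |GG u₁ f (t, x)|) +
      ∫ s in (0:ℝ)..t, ((8 / R) * (∫ x in KK R, |ww R u (s, x)| * |GG u₁ f (s, x)|) +
        2 * ∫ x in KK R, |ww R u (s, x)| * |f (s, x)|) := by
  obtain ⟨h0, h1, h2⟩ := vd_smooth u hu
  have o : (1 : WithTop ℕ∞) ≤ ((⊤ : ℕ∞) : WithTop ℕ∞) := by exact_mod_cast le_top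
  have cu := hu.continuous
  have c0 := h0.continuous
  have c1 := h1.continuous
  have c2 := h2.continuous
  have c11 := (vd_cont _ (h1.of_le o)).2.1
  have c22 := (vd_cont _ (h2.of_le o)).2.2
  have pv := prim_cont u cu
  have pv1 := prim_cont _ c1
  have pv2 := prim_cont _ c2
  have pv11 := prim_cont _ c11
  have pv22 := prim_cont _ c22
  have cG := GG_cont u₁ f hu₁ hf
  have cw := ww_cont R u cu
  have ce := eta_cont R
  obtain ⟨cj1, cj2⟩ := j_cont
  -- the densities
  set Φ : Pt → ℝ := fun p => ee R u p - 2 * (eta R p ^ 4 * (prim u p * GG u₁ f p)) with hΦ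
  set Φ' : Pt → ℝ := fun p =>
    (-(4 * eta R p ^ 3 / R) * (u p ^ 2 + prim (vd1 u) p ^ 2 + prim (vd2 u) p ^ 2) +
      eta R p ^ 4 * (2 * u p * vdt u p + 2 * prim (vd1 u) p * vd1 u p + 2 * prim (vd2 u) p * vd2 u p))
      - 2 * (-(4 * eta R p ^ 3 / R) * (prim u p * GG u₁ f p) +
        eta R p ^ 4 * (u p * GG u₁ f p + prim u p * f p)) with hΦ'
  set k1 : Pt → ℝ := fun p => eta R p ^ 4 * (prim (vd1 u) p * u p) with hk1
  set k2 : Pt → ℝ := fun p => eta R p ^ 4 * (prim (vd2 u) p * u p) with hk2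
  set k1' : Pt → ℝ := fun p => -(4 * eta R p ^ 3 / R) * j1 p * (prim (vd1 u) p * u p) +
    eta R p ^ 4 * (prim (vd1 (vd1 u)) p * u p + prim (vd1 u) p * vd1 u p) with hk1'
  set k2' : Pt → ℝ := fun p => -(4 * eta R p ^ 3 / R) * j2 p * (prim (vd2 u) p * u p) +
    eta R p ^ 4 * (prim (vd2 (vd2 u)) p * u p + prim (vd2 u) p * vd2 u p) with hk2'
  have cΦ : Continuous Φ := by have := ee_cont R u (hu.of_le o); fun_prop
  have cΦ' : Continuous Φ' := by fun_prop
  have ck1' : Continuous k1' := by fun_prop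
  have ck2' : Continuous k2' := by fun_prop
  have dE : ∀ s x, HasDerivAt (fun s => eta R (s, x) ^ 4) (-(4 * eta R (s, x) ^ 3 / R)) s := by
    intro s x
    have := eta_dt R 2 s x
    norm_num at this
    simpa using this
  have fE : ∀ s x, HasFDerivAt (fun x => eta R (s, x) ^ 4)
      (lf (-(4 * eta R (s, x) ^ 3 / R) * j1 (s, x)) (-(4 * eta R (s, x) ^ 3 / R) * j2 (s, x))) x := by
    intro s x
    have := eta_fd R 2 s x
    norm_num at this
    simpa using this
  have dG : ∀ s x, HasDerivAt (fun s => GG u₁ f (s, x)) (f (s, x)) s := fun s x =>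
    (prim_dt f hf s x).const_add (u₁ x)
  have dΦ : ∀ s x, HasDerivAt (fun s => Φ (s, x)) (Φ' (s, x)) s := by
    intro s x
    have a1 := (time_d u (hu.of_le o) s x).pow 2
    have a2 := (prim_dt _ c1 s x).pow 2
    have a3 := (prim_dt _ c2 s x).pow 2
    have b := (dE s x).mul ((a1.add a2).add a3)
    have c := ((dE s x).mul ((prim_dt u cu s x).mul (dG s x))).const_mul 2
    convert! b.sub c using 1
    simp only [hΦ', Pi.add_apply, Pi.pow_apply, Pi.mul_apply]
    push_cast
    ring
  have dk1 : ∀ s x y, HasDerivAt (fun x => k1 (s, (x, y))) (k1' (s, (x, y))) x := by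
    intro s x y
    have a := fd_d1 _ _ _ _ _ (fE s (x, y))
    have b := fd_d1 _ _ _ _ _ (prim_fd _ (h1.of_le o) s (x, y))
    have c := fd_d1 _ _ _ _ _ (space_fd u (hu.of_le o) s (x, y))
    exact a.mul (b.mul c)
  have dk2 : ∀ s x y, HasDerivAt (fun y => k2 (s, (x, y))) (k2' (s, (x, y))) y := by
    intro s x y
    have a := fd_d2 _ _ _ _ _ (fE s (x, y))
    have b := fd_d2 _ _ _ _ _ (prim_fd _ (h2.of_le o) s (x, y))
    have c := fd_d2 _ _ _ _ _ (space_fd u (hu.of_le o) s (x, y))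
    exact a.mul (b.mul c)
  have z1 : ∀ s, 0 ≤ s → ∫ x in KK R, k1' (s, x) = 0 := by
    intro s hs
    refine div1 R hR (fun x => k1 (s, x)) (fun x => k1' (s, x)) (by fun_prop) (dk1 s) fun y => ?_
    constructor <;>
    · simp only [hk1]
      rw [eta_zero R hR _ hs]
      · simp
      · refine le_trans ?_ (norm_fst_le _)
        simp [abs_of_pos hR]
  have z2 : ∀ s, 0 ≤ s → ∫ x in KK R, k2' (s, x) = 0 := by
    intro s hs
    refine div2 R hR (fun x => k2 (s, x)) (fun x => k2' (s, x)) (by fun_prop) (dk2 s) fun y => ?_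
    constructor <;>
    · simp only [hk2]
      rw [eta_zero R hR _ hs]
      · simp
      · refine le_trans ?_ (norm_snd_le _)
        simp [abs_of_pos hR]
  have hη4 : ∀ s x, 0 ≤ s → ∀ z : ℝ, |eta R (s, x) ^ 4 * (prim u (s, x) * z)| ≤
      |ww R u (s, x)| * |z| := by
    intro s x hs z
    have e1 : eta R (s, x) ^ 4 * (prim u (s, x) * z) = eta R (s, x) * (ww R u (s, x) * z) := by
      simp only [ww]; ring
    rw [e1, abs_mul, abs_mul, abs_of_nonneg (eta_nonneg _ _)]
    exact mul_le_of_le_one_left (by positivity) (eta_le R hR _ hs)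
  have pt : ∀ s x, 0 ≤ s → Φ' (s, x) ≤ 2 * k1' (s, x) + 2 * k2' (s, x) +
      ((8 / R) * (|ww R u (s, x)| * |GG u₁ f (s, x)|) + 2 * (|ww R u (s, x)| * |f (s, x)|)) := by
    intro s x hs
    have q := equ u₁ f u hf hu hbox hu1 s hs x
    have jl := j_le (s, x)
    have A1 : (8 / R) * (ww R u (s, x) * GG u₁ f (s, x)) ≤
        (8 / R) * (|ww R u (s, x)| * |GG u₁ f (s, x)|) := by
      rw [← abs_mul]; gcongr; exact le_abs_self _
    have A2 := (neg_le_abs _).trans (hη4 s x hs (f (s, x)))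
    have A3 : 0 ≤ (4 * eta R (s, x) ^ 3 / R) *
        ((prim (vd1 u) (s, x) - u (s, x) * j1 (s, x)) ^ 2 +
          (prim (vd2 u) (s, x) - u (s, x) * j2 (s, x)) ^ 2 +
          u (s, x) ^ 2 * (1 - (j1 (s, x) ^ 2 + j2 (s, x) ^ 2))) := by
      have := eta_nonneg R (s, x)
      have : 0 ≤ 1 - (j1 (s, x) ^ 2 + j2 (s, x) ^ 2) := by linarith
      positivity
    have key : Φ' (s, x) = 2 * k1' (s, x) + 2 * k2' (s, x)
        + (8 / R) * (ww R u (s, x) * GG u₁ f (s, x))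
        + 2 * (-(eta R (s, x) ^ 4 * (prim u (s, x) * f (s, x))))
        - (4 * eta R (s, x) ^ 3 / R) *
        ((prim (vd1 u) (s, x) - u (s, x) * j1 (s, x)) ^ 2 +
          (prim (vd2 u) (s, x) - u (s, x) * j2 (s, x)) ^ 2 +
          u (s, x) ^ 2 * (1 - (j1 (s, x) ^ 2 + j2 (s, x) ^ 2))) := by
      simp only [hΦ', hk1', hk2', ww]
      rw [← q]
      ring
    rw [key]
    linarith
  -- integrate
  have I1 : (∫ x in KK R, Φ (t, x)) - ∫ x in KK R, Φ (0, x) =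
      ∫ s in (0:ℝ)..t, ∫ x in KK R, Φ' (s, x) := by
    rw [← swapK R t Φ' cΦ' ht, ← integral_sub (KK_int R _ (by fun_prop)) (KK_int R _ (by fun_prop))]
    refine integral_congr_ae (.of_forall fun x => ?_)
    simp only
    rw [intervalIntegral.integral_eq_sub_of_hasDerivAt (fun s _ => dΦ s x)
      (Continuous.intervalIntegrable (by fun_prop) _ _)]
  have cpar : ∀ F : Pt → ℝ, Continuous F → Continuous (fun s => ∫ x in KK R, F (s, x)) := by
    intro F hF
    exact continuous_parametric_integral_of_continuous (f := fun s x => F (s, x))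
      (by simpa [Function.uncurry_def] using hF) (KK_compact R)
  have cWG := cpar (fun p => |ww R u p| * |GG u₁ f p|) (by fun_prop)
  have cWf := cpar (fun p => |ww R u p| * |f p|) (by fun_prop)
  have I2 : ∫ s in (0:ℝ)..t, ∫ x in KK R, Φ' (s, x) ≤
      ∫ s in (0:ℝ)..t, ((8 / R) * (∫ x in KK R, |ww R u (s, x)| * |GG u₁ f (s, x)|) +
        2 * ∫ x in KK R, |ww R u (s, x)| * |f (s, x)|) := by
    refine intervalIntegral.integral_mono_on ht ((cpar _ cΦ').intervalIntegrable _ _)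
      (Continuous.intervalIntegrable ((continuous_const.mul cWG).add (continuous_const.mul cWf)) _ _) fun s hs => ?_
    have m := setIntegral_mono (μ := volume) (s := KK R) (KK_int R _ (by fun_prop : Continuous fun x => Φ' (s, x)))
      (KK_int R _ (by fun_prop)) (fun x => pt s x hs.1)
    refine m.trans_eq ?_
    have i1 : IntegrableOn (fun x => 2 * k1' (s, x)) (KK R) := KK_int R _ (by fun_prop)
    have i2 : IntegrableOn (fun x => 2 * k2' (s, x)) (KK R) := KK_int R _ (by fun_prop)
    have i12 : IntegrableOn (fun x => 2 * k1' (s, x) + 2 * k2' (s, x)) (KK R) := i1.add i2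
    have i3 : IntegrableOn (fun x => (8 / R) * (|ww R u (s, x)| * |GG u₁ f (s, x)|)) (KK R) :=
      KK_int R _ (by fun_prop)
    have i4 : IntegrableOn (fun x => 2 * (|ww R u (s, x)| * |f (s, x)|)) (KK R) :=
      KK_int R _ (by fun_prop)
    have i34 : IntegrableOn (fun x => (8 / R) * (|ww R u (s, x)| * |GG u₁ f (s, x)|) +
      2 * (|ww R u (s, x)| * |f (s, x)|)) (KK R) := i3.add i4
    rw [integral_add i12 i34, integral_add i1 i2, integral_add i3 i4]
    simp only [integral_const_mul]
    rw [z1 s hs.1, z2 s hs.1]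
    ring
  have I3 : ∫ x in KK R, Φ (0, x) = ∫ x in KK R, ee R u (0, x) := by
    refine integral_congr_ae (.of_forall fun x => ?_)
    simp [hΦ, prim]
  have I4 : (∫ x in KK R, ee R u (t, x)) ≤ (∫ x in KK R, Φ (t, x)) +
      2 * ∫ x in KK R, |ww R u (t, x)| * |GG u₁ f (t, x)| := by
    rw [← integral_const_mul, ← integral_add (KK_int R _ (by fun_prop)) (KK_int R _ (by fun_prop))]
    have := ee_cont R u (hu.of_le o)
    refine setIntegral_mono (KK_int R _ (by fun_prop)) (KK_int R _ (by fun_prop)) fun x => ?_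
    have := (le_abs_self _).trans (hη4 t x ht (GG u₁ f (t, x)))
    simp only [hΦ]
    linarith
  linarith
end

section
open MeasureTheory ENNReal Topology

lemma cs_int (g : ℝ → ℝ) (hg : Continuous g) (s : ℝ) (hs : 0 ≤ s) :
    (∫ σ in (0:ℝ)..s, g σ) ^ 2 ≤ s * ∫ σ in (0:ℝ)..s, g σ ^ 2 := by
  rcases hs.eq_or_lt with h | h
  · subst h; simp
  set I := ∫ σ in (0:ℝ)..s, g σ with hI
  have h0 : 0 ≤ ∫ σ in (0:ℝ)..s, (s * g σ - I) ^ 2 :=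
    intervalIntegral.integral_nonneg hs fun σ _ => sq_nonneg _
  have e : ∫ σ in (0:ℝ)..s, (s * g σ - I) ^ 2 =
      s ^ 2 * (∫ σ in (0:ℝ)..s, g σ ^ 2) - (2 * s * I) * I + s * I ^ 2 := by
    have e1 : (fun σ => (s * g σ - I) ^ 2) = fun σ => s ^ 2 * g σ ^ 2 - (2 * s * I) * g σ + I ^ 2 := by
      funext σ; ring
    rw [e1, intervalIntegral.integral_add (Continuous.intervalIntegrable (by fun_prop) _ _)
      (Continuous.intervalIntegrable (by fun_prop) _ _),
      intervalIntegral.integral_sub (Continuous.intervalIntegrable (by fun_prop) _ _)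
      (Continuous.intervalIntegrable (by fun_prop) _ _), intervalIntegral.integral_const_mul,
      intervalIntegral.integral_const_mul, intervalIntegral.integral_const]
    simp [← hI]
  rw [e] at h0
  by_contra hc
  push Not at hc
  nlinarith [mul_lt_mul_of_pos_left hc h]

lemma parK (R : ℝ) (F : Pt → ℝ) (hF : Continuous F) : Continuous (fun s => ∫ x in KK R, F (s, x)) :=
  continuous_parametric_integral_of_continuous (f := fun s x => F (s, x))
      (by simpa [Function.uncurry_def] using hF) (KK_compact R)

lemma vbound (R : ℝ) (hR : 0 < R) (u : Pt → ℝ) (hu : ContDiff ℝ 1 u) (T M : ℝ)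
    (hM : ∀ s ∈ Set.Icc (0:ℝ) T, ∫ x in KK R, ee R u (s, x) ≤ M ^ 2)
    (s : ℝ) (hs : s ∈ Set.Icc (0:ℝ) T) :
    ∫ x in KK R, eta R (s, x) ^ 4 * prim u (s, x) ^ 2 ≤ (T * M) ^ 2 := by
  have ce := ee_cont R u hu
  have cη := eta_cont R
  have cu := hu.continuous
  have cp := prim_cont u cu
  have pt : ∀ x, eta R (s, x) ^ 4 * prim u (s, x) ^ 2 ≤ s * ∫ σ in (0:ℝ)..s, ee R u (σ, x) := by
    intro x
    have h1 := cs_int (fun σ => u (σ, x)) (by fun_prop) s hs.1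
    have hη := eta_nonneg R (s, x)
    calc eta R (s, x) ^ 4 * prim u (s, x) ^ 2
        ≤ eta R (s, x) ^ 4 * (s * ∫ σ in (0:ℝ)..s, u (σ, x) ^ 2) := by
          gcongr; exact h1
      _ = s * ∫ σ in (0:ℝ)..s, eta R (s, x) ^ 4 * u (σ, x) ^ 2 := by
          rw [intervalIntegral.integral_const_mul]; ring
      _ ≤ _ := by
          refine mul_le_mul_of_nonneg_left ?_ hs.1
          refine intervalIntegral.integral_mono_on hs.1
            (Continuous.intervalIntegrable (by fun_prop) _ _)
            (Continuous.intervalIntegrable (by fun_prop) _ _) fun σ hσ => ?_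
          have := eta_anti R hR σ s hσ.2 x
          unfold ee
          have : eta R (s, x) ^ 4 ≤ eta R (σ, x) ^ 4 := by gcongr
          have h3 : 0 ≤ eta R (σ, x) ^ 4 := by have := eta_nonneg R (σ, x); positivity
          apply mul_le_mul this _ (sq_nonneg _) h3
          nlinarith [sq_nonneg (prim (vd1 u) (σ, x)), sq_nonneg (prim (vd2 u) (σ, x))]
  have c1 : Continuous fun x : ℝ × ℝ => s * ∫ σ in (0:ℝ)..s, ee R u (σ, x) := by
    have : Continuous fun x : ℝ × ℝ => s * prim (ee R u) (s, x) := by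
      have := prim_cont _ ce
      fun_prop
    exact this
  calc _ ≤ ∫ x in KK R, s * ∫ σ in (0:ℝ)..s, ee R u (σ, x) :=
        setIntegral_mono (KK_int R _ (by fun_prop)) (KK_int R _ c1) pt
    _ = s * ∫ σ in (0:ℝ)..s, ∫ x in KK R, ee R u (σ, x) := by
        rw [integral_const_mul, swapK R s _ ce hs.1]
    _ ≤ s * ∫ σ in (0:ℝ)..s, M ^ 2 := by
        refine mul_le_mul_of_nonneg_left ?_ hs.1
        refine intervalIntegral.integral_mono_on hs.1
            ((parK R _ ce).intervalIntegrable _ _)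
            (Continuous.intervalIntegrable (by fun_prop) _ _) fun σ hσ =>
            hM σ ⟨hσ.1, hσ.2.trans hs.2⟩
    _ = (s * M) ^ 2 := by rw [intervalIntegral.integral_const]; simp; ring
    _ ≤ (T * M) ^ 2 := by
        rw [mul_pow, mul_pow]
        have := hs.1
        have := hs.2
        gcongr

lemma l2_le {E : Type*} [NormedAddCommGroup E] (R : ℝ) (g : ℝ × ℝ → E) (h : ℝ × ℝ → ℝ)
    (hh : Continuous h) (hz : ∀ x, x ∉ KK R → g x = 0) (hgh : ∀ x, ‖g x‖ ^ 2 ≤ h x) (B : ℝ)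
    (hB : 0 ≤ B) (hI : ∫ x in KK R, h x ≤ B ^ 2) : eLpNorm g 2 volume ≤ ENNReal.ofReal B := by
  rw [eLpNorm_eq_lintegral_rpow_enorm_toReal (by norm_num) (by norm_num)]
  have h1 : ∫⁻ x, ‖g x‖ₑ ^ (2:ℝ≥0∞).toReal ≤ ENNReal.ofReal B ^ 2 := by
    calc ∫⁻ x, ‖g x‖ₑ ^ (2:ℝ≥0∞).toReal
        = ∫⁻ x in KK R, ‖g x‖ₑ ^ (2:ℝ≥0∞).toReal := by
          rw [setLIntegral_eq_of_support_subset]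
          intro x hx
          by_contra hc
          exact hx (by simp [hz x hc])
      _ ≤ ∫⁻ x in KK R, ENNReal.ofReal (h x) := by
          refine lintegral_mono fun x => ?_
          rw [← ofReal_norm]
          simp only [toReal_ofNat, ENNReal.rpow_ofNat]
          rw [← ENNReal.ofReal_pow (norm_nonneg _)]
          exact ENNReal.ofReal_le_ofReal (hgh x)
      _ = ENNReal.ofReal (∫ x in KK R, h x) := by
          rw [ofReal_integral_eq_lintegral_ofReal (KK_int R h hh)]
          exact .of_forall fun x => (sq_nonneg _).trans (hgh x)
      _ ≤ _ := by
          rw [← ENNReal.ofReal_pow hB]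
          exact ENNReal.ofReal_le_ofReal hI
  calc _ ≤ (ENNReal.ofReal B ^ 2) ^ (1 / (2:ℝ≥0∞).toReal) := by gcongr
    _ = _ := by
      rw [← ENNReal.rpow_natCast, ← ENNReal.rpow_mul]; norm_num

lemma ww_fd (R : ℝ) (u : Pt → ℝ) (hu : ContDiff ℝ 1 u) (s : ℝ) (x : ℝ × ℝ) :
    HasFDerivAt (fun x => ww R u (s, x))
      (lf (eta R (s, x) ^ 3 * prim (vd1 u) (s, x) - 3 * eta R (s, x) ^ 2 / R * j1 (s, x) * prim u (s, x))
        (eta R (s, x) ^ 3 * prim (vd2 u) (s, x) - 3 * eta R (s, x) ^ 2 / R * j2 (s, x) * prim u (s, x)))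
      x := by
  have a := eta_fd R 1 s x
  have b := prim_fd u hu s x
  convert! a.mul b using 1
  apply ContinuousLinearMap.ext; intro y
  simp [lf_apply]
  ring

lemma ww_bounds (R : ℝ) (hR : 0 < R) (u : Pt → ℝ) (hu : ContDiff ℝ 1 u) (T M : ℝ) (hM0 : 0 ≤ M)
    (hRT : T ≤ R) (hM : ∀ s ∈ Set.Icc (0:ℝ) T, ∫ x in KK R, ee R u (s, x) ≤ M ^ 2)
    (s : ℝ) (hs : s ∈ Set.Icc (0:ℝ) T) :
    ContDiff ℝ 1 (fun x => ww R u (s, x)) ∧ HasCompactSupport (fun x => ww R u (s, x)) ∧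
    eLpNorm (fun x => ww R u (s, x)) 2 volume * eLpNorm (fderiv ℝ (fun x => ww R u (s, x))) 2 volume
      ≤ ENNReal.ofReal ((Real.sqrt (7 * T) * M) ^ 2) := by
  have hT : 0 ≤ T := hs.1.trans hs.2
  have ce := ee_cont R u hu
  have cη := eta_cont R
  have cu := hu.continuous
  have cp := prim_cont u cu
  obtain ⟨-, c1, c2⟩ := vd_cont u hu
  have cp1 := prim_cont _ c1
  have cp2 := prim_cont _ c2
  obtain ⟨cj1, cj2⟩ := j_cont
  have hz : ∀ x, x ∉ KK R → eta R (s, x) = 0 := fun x hx =>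
    eta_zero R hR _ hs.1 (KK_notMem R x hx)
  have hfd : fderiv ℝ (fun x => ww R u (s, x)) = fun x => (lf (eta R (s, x) ^ 3 * prim (vd1 u) (s, x) - 3 * eta R (s, x) ^ 2 / R * j1 (s, x) * prim u (s, x))
        (eta R (s, x) ^ 3 * prim (vd2 u) (s, x) - 3 * eta R (s, x) ^ 2 / R * j2 (s, x) * prim u (s, x))) := by
    funext x; exact (ww_fd R u hu s x).fderiv
  have V := vbound R hR u hu T M hM s hs
  refine ⟨?_, ?_, ?_⟩
  · rw [contDiff_one_iff_fderiv]
    refine ⟨fun x => (ww_fd R u hu s x).differentiableAt, ?_⟩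
    rw [hfd]
    exact lf_cont _ _ (by fun_prop) (by fun_prop)
  · refine HasCompactSupport.intro (KK_compact R) fun x hx => ?_
    simp [ww, hz x hx]
  · have b1 : eLpNorm (fun x => ww R u (s, x)) 2 volume ≤ ENNReal.ofReal (T * M) := by
      refine l2_le R _ (fun x => eta R (s, x) ^ 4 * prim u (s, x) ^ 2) (by fun_prop) ?_ ?_ _
        (by positivity) V
      · intro x hx; simp [ww, hz x hx]
      · intro x
        have e1 := eta_nonneg R (s, x)
        have e2 := eta_le R hR (s, x) hs.1
        rw [Real.norm_eq_abs, sq_abs, ww, mul_pow, ← pow_mul]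
        exact mul_le_mul_of_nonneg_right (pow_le_pow_of_le_one e1 e2 (by norm_num)) (sq_nonneg _)
    have b2 : eLpNorm (fderiv ℝ (fun x => ww R u (s, x))) 2 volume ≤ ENNReal.ofReal (7 * M) := by
      refine l2_le R _ (fun x => 4 * ee R u (s, x) + 36 / R ^ 2 * (eta R (s, x) ^ 4 * prim u (s, x) ^ 2))
        (by fun_prop) ?_ ?_ _ (by positivity) ?_
      · intro x hx
        rw [hfd]
        simp [hz x hx, lf]
      · intro x
        rw [hfd]
        have e1 := eta_nonneg R (s, x)
        have e2 := eta_le R hR (s, x) hs.1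
        have e3 := j_le (s, x)
        simp only [ee]
        set η := eta R (s, x)
        set p := prim (vd1 u) (s, x)
        set q := prim (vd2 u) (s, x)
        set v := prim u (s, x)
        set a := j1 (s, x)
        set b := j2 (s, x)
        have e4 : η ^ 6 ≤ η ^ 4 := pow_le_pow_of_le_one e1 e2 (by norm_num)
        set z := 3 * η ^ 2 / R * v with hzd
        have hzz : z ^ 2 = 9 / R ^ 2 * (η ^ 4 * v ^ 2) := by
          rw [hzd]; field_simp; ring
        have n1 := lf_norm (η ^ 3 * p - 3 * η ^ 2 / R * a * v) (η ^ 3 * q - 3 * η ^ 2 / R * b * v)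
        have r1 : η ^ 3 * p - 3 * η ^ 2 / R * a * v = η ^ 3 * p - a * z := by rw [hzd]; ring
        have r2 : η ^ 3 * q - 3 * η ^ 2 / R * b * v = η ^ 3 * q - b * z := by rw [hzd]; ring
        rw [r1, r2] at n1 ⊢
        calc _ ≤ (|η ^ 3 * p - a * z| + |η ^ 3 * q - b * z|) ^ 2 := by gcongr
          _ ≤ 2 * ((η ^ 3 * p - a * z) ^ 2 + (η ^ 3 * q - b * z) ^ 2) := by
            nlinarith [sq_nonneg (|η ^ 3 * p - a * z| - |η ^ 3 * q - b * z|),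
              sq_abs (η ^ 3 * p - a * z), sq_abs (η ^ 3 * q - b * z)]
          _ ≤ 4 * (η ^ 6 * (p ^ 2 + q ^ 2)) + 4 * ((a ^ 2 + b ^ 2) * z ^ 2) := by
            nlinarith [sq_nonneg (η ^ 3 * p + a * z), sq_nonneg (η ^ 3 * q + b * z)]
          _ ≤ 4 * (η ^ 4 * (u (s, x) ^ 2 + p ^ 2 + q ^ 2)) + 4 * (1 * z ^ 2) := by
            gcongr
            nlinarith [sq_nonneg (u (s, x))]
          _ = _ := by rw [hzz]; ring
      · have i1 : IntegrableOn (fun x => 4 * ee R u (s, x)) (KK R) := KK_int R _ (by fun_prop)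
        have i2 : IntegrableOn (fun x => 36 / R ^ 2 * (eta R (s, x) ^ 4 * prim u (s, x) ^ 2)) (KK R) :=
          KK_int R _ (by fun_prop)
        rw [integral_add i1 i2, integral_const_mul, integral_const_mul]
        have h1 := hM s hs
        have h2 : 36 / R ^ 2 * (∫ x in KK R, eta R (s, x) ^ 4 * prim u (s, x) ^ 2) ≤
            36 / R ^ 2 * (R * M) ^ 2 := by
          gcongr
          exact V.trans (by gcongr)
        have h3 : 36 / R ^ 2 * (R * M) ^ 2 = 36 * M ^ 2 := by field_simp
        nlinarith [sq_nonneg M]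
    calc _ ≤ ENNReal.ofReal (T * M) * ENNReal.ofReal (7 * M) := by gcongr
      _ = ENNReal.ofReal ((Real.sqrt (7 * T) * M) ^ 2) := by
        rw [← ENNReal.ofReal_mul (by positivity), mul_pow, Real.sq_sqrt (by positivity)]
        congr 1; ring

lemma ofReal_K (R : ℝ) (w g : ℝ × ℝ → ℝ) (hw : Continuous w) (hg : Continuous g) :
    ENNReal.ofReal (∫ x in KK R, |w x| * |g x|) ≤ ∫⁻ x, ‖g x‖ₑ * ‖w x‖ₑ := by
  rw [ofReal_integral_eq_lintegral_ofReal (KK_int R _ (by fun_prop))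
    (.of_forall fun x => by positivity)]
  refine (setLIntegral_le_lintegral _ _).trans (lintegral_mono fun x => ?_)
  rw [mul_comm, ENNReal.ofReal_mul (abs_nonneg _), Real.enorm_eq_ofReal_abs, Real.enorm_eq_ofReal_abs]

lemma pairG (u₁ : ℝ × ℝ → ℝ) (f : Pt → ℝ) (w : ℝ × ℝ → ℝ) (hu₁ : Continuous u₁) (hf : Continuous f)
    (hw : Continuous w) (K : ℝ≥0∞) (hK : K ≠ ⊤) (T s : ℝ) (hs : s ∈ Set.Icc (0:ℝ) T)
    (h1 : ∫⁻ x, ‖u₁ x‖ₑ * ‖w x‖ₑ ≤ K * eLpNorm u₁ (4 / 3) volume)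
    (h2 : ∀ σ ≥ 0, ∫⁻ x, ‖f (σ, x)‖ₑ * ‖w x‖ₑ ≤ K * Nrm f σ) :
    ∫⁻ x, ‖GG u₁ f (s, x)‖ₑ * ‖w x‖ₑ ≤
      K * (eLpNorm u₁ (4 / 3) volume + ∫⁻ σ in Set.Icc (0:ℝ) T, Nrm f σ) := by
  have m1 : Measurable fun x => ‖u₁ x‖ₑ * ‖w x‖ₑ := by fun_prop
  calc ∫⁻ x, ‖GG u₁ f (s, x)‖ₑ * ‖w x‖ₑ
      ≤ ∫⁻ x, (‖u₁ x‖ₑ * ‖w x‖ₑ + ∫⁻ σ in Set.Ioc 0 s, ‖f (σ, x)‖ₑ * ‖w x‖ₑ) := by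
        refine lintegral_mono fun x => ?_
        have m2 : Measurable fun σ => ‖f (σ, x)‖ₑ := by
          have : Continuous fun σ => f (σ, x) := by fun_prop
          exact this.measurable.enorm
        simp only
        rw [lintegral_mul_const _ m2, ← add_mul]
        gcongr
        simp only [GG, prim]
        refine (enorm_add_le _ _).trans ?_
        gcongr
        rw [intervalIntegral.integral_of_le hs.1]
        exact enorm_integral_le_lintegral_enorm _
    _ = (∫⁻ x, ‖u₁ x‖ₑ * ‖w x‖ₑ) + ∫⁻ x, ∫⁻ σ in Set.Ioc 0 s, ‖f (σ, x)‖ₑ * ‖w x‖ₑ :=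
        lintegral_add_left m1 _
    _ = (∫⁻ x, ‖u₁ x‖ₑ * ‖w x‖ₑ) + ∫⁻ σ in Set.Ioc 0 s, ∫⁻ x, ‖f (σ, x)‖ₑ * ‖w x‖ₑ := by
        congr 1
        apply lintegral_lintegral_swap
        have a1 : Continuous fun z : (ℝ × ℝ) × ℝ => f (z.2, z.1) := by fun_prop
        have a2 : Continuous fun z : (ℝ × ℝ) × ℝ => w z.1 := by fun_prop
        exact (a1.measurable.enorm.mul a2.measurable.enorm).aemeasurable
    _ ≤ K * eLpNorm u₁ (4 / 3) volume + ∫⁻ σ in Set.Ioc 0 s, K * Nrm f σ := by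
        refine add_le_add h1 ?_
        refine setLIntegral_mono' measurableSet_Ioc fun σ hσ => h2 σ hσ.1.le
    _ ≤ _ := by
        rw [mul_add, lintegral_const_mul' _ _ hK]
        gcongr
        exact Set.Ioc_subset_Icc_self.trans (Set.Icc_subset_Icc_right hs.2)
end

section
open MeasureTheory ENNReal Topology

lemma Mbound (C : ℝ) (hC : 0 < C)
    (hP : ∀ w : ℝ × ℝ → ℝ, ContDiff ℝ 1 w → HasCompactSupport w → ∀ D : ℝ, 0 ≤ D →
      eLpNorm w 2 volume * eLpNorm (fderiv ℝ w) 2 volume ≤ ENNReal.ofReal (D ^ 2) →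
      (∀ g : ℝ × ℝ → ℝ, Measurable g →
        ∫⁻ x, ‖g x‖ₑ * ‖w x‖ₑ ≤ ENNReal.ofReal (C * D) * eLpNorm g (4 / 3) volume) ∧
      (∀ f : Pt → ℝ, Continuous f → ∀ τ ≥ 0, HasCompactSupport (fun x => f (τ, x)) →
        ∫⁻ x, ‖f (τ, x)‖ₑ * ‖w x‖ₑ ≤ ENNReal.ofReal (C * D) * Nrm f τ))
    (u₁ : ℝ × ℝ → ℝ) (f u : Pt → ℝ) (hu₁ : Continuous u₁)
    (hf : Continuous f) (hfs : ∀ τ : ℝ, HasCompactSupport (fun x : ℝ × ℝ => f (τ, x)))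
    (hu : ContDiff ℝ (⊤ : ℕ∞) u)
    (hbox : ∀ p : Pt, 0 ≤ p.1 → box u p = f p) (hu1 : ∀ x : ℝ × ℝ, vdt u (0, x) = u₁ x)
    (T : ℝ) (hT : 0 ≤ T) (N a : ℝ) (hN : 0 ≤ N) (ha : 0 ≤ a)
    (hN' : eLpNorm u₁ (4 / 3) volume + ∫⁻ σ in Set.Icc (0:ℝ) T, Nrm f σ = ENNReal.ofReal N)
    (R : ℝ) (hR : 0 < R) (hRT : T ≤ R)
    (ha' : ∫ x in KK R, ee R u (0, x) ≤ a ^ 2) :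
    ∫ x in KK R, ee R u (T, x) ≤ (a + 12 * C * Real.sqrt (7 * T) * N) ^ 2 := by
  have o : (1 : WithTop ℕ∞) ≤ ((⊤ : ℕ∞) : WithTop ℕ∞) := by exact_mod_cast le_top
  have hu' := hu.of_le o
  have ce := ee_cont R u hu'
  have cw := ww_cont R u hu.continuous
  have cG := GG_cont u₁ f hu₁ hf
  have cE := parK R _ ce
  have ee_nn : ∀ p, 0 ≤ ee R u p := fun p => by
    unfold ee; have := eta_nonneg R p; positivity
  obtain ⟨s₀, hs₀, hmax⟩ := (isCompact_Icc (a := (0:ℝ)) (b := T)).exists_isMaxOn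
    ⟨0, le_rfl, hT⟩ cE.continuousOn
  set M := Real.sqrt (∫ x in KK R, ee R u (s₀, x)) with hMd
  have hM0 : 0 ≤ M := Real.sqrt_nonneg _
  have hMsq : M ^ 2 = ∫ x in KK R, ee R u (s₀, x) :=
    Real.sq_sqrt (integral_nonneg fun x => ee_nn _)
  have hM : ∀ s ∈ Set.Icc (0:ℝ) T, ∫ x in KK R, ee R u (s, x) ≤ M ^ 2 := by
    intro s hs; rw [hMsq]; exact hmax hs
  set D := Real.sqrt (7 * T) * M with hD
  have hD0 : 0 ≤ D := by positivity
  have pr : ∀ s ∈ Set.Icc (0:ℝ) T,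
      (∫⁻ x, ‖u₁ x‖ₑ * ‖ww R u (s, x)‖ₑ ≤ ENNReal.ofReal (C * D) * eLpNorm u₁ (4 / 3) volume) ∧
      (∀ σ ≥ 0, ∫⁻ x, ‖f (σ, x)‖ₑ * ‖ww R u (s, x)‖ₑ ≤ ENNReal.ofReal (C * D) * Nrm f σ) := by
    intro s hs
    obtain ⟨w1, w2, w3⟩ := ww_bounds R hR u hu' T M hM0 hRT hM s hs
    obtain ⟨q1, q2⟩ := hP _ w1 w2 D hD0 w3
    exact ⟨q1 u₁ hu₁.measurable, fun σ hσ => q2 f hf σ hσ (hfs σ)⟩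
  have bG : ∀ s ∈ Set.Icc (0:ℝ) T, ∫ x in KK R, |ww R u (s, x)| * |GG u₁ f (s, x)| ≤ C * D * N := by
    intro s hs
    have h1 := ofReal_K R (fun x => ww R u (s, x)) (fun x => GG u₁ f (s, x)) (by fun_prop) (by fun_prop)
    have h2 := pairG u₁ f (fun x => ww R u (s, x)) hu₁ hf (by fun_prop) _ ENNReal.ofReal_ne_top T s hs
      (pr s hs).1 (pr s hs).2
    rw [hN', ← ENNReal.ofReal_mul (by positivity)] at h2
    exact (ENNReal.ofReal_le_ofReal_iff (by positivity)).1 (h1.trans h2)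
  have cF : Continuous fun s => ∫ x in KK R, |ww R u (s, x)| * |f (s, x)| :=
    parK R (fun p => |ww R u p| * |f p|) (by fun_prop)
  have cGG : Continuous fun s => ∫ x in KK R, |ww R u (s, x)| * |GG u₁ f (s, x)| :=
    parK R (fun p => |ww R u p| * |GG u₁ f p|) (by fun_prop)
  have bF : ∫ s in (0:ℝ)..s₀, ∫ x in KK R, |ww R u (s, x)| * |f (s, x)| ≤ C * D * N := by
    refine (ENNReal.ofReal_le_ofReal_iff (by positivity)).1 ?_
    rw [intervalIntegral.integral_of_le hs₀.1, ofReal_integral_eq_lintegral_ofReal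
      (cF.continuousOn.integrableOn_compact isCompact_Icc |>.mono_set Set.Ioc_subset_Icc_self)
      (.of_forall fun s => integral_nonneg fun x => by positivity)]
    calc _ ≤ ∫⁻ s in Set.Ioc 0 s₀, ENNReal.ofReal (C * D) * Nrm f s := by
          refine setLIntegral_mono' measurableSet_Ioc fun s hs => ?_
          exact (ofReal_K R (fun x => ww R u (s, x)) (fun x => f (s, x)) (by fun_prop)
            (by fun_prop)).trans ((pr s ⟨hs.1.le, hs.2.trans hs₀.2⟩).2 s hs.1.le)
      _ ≤ ENNReal.ofReal (C * D) * ∫⁻ s in Set.Icc 0 T, Nrm f s := by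
          rw [lintegral_const_mul' _ _ ENNReal.ofReal_ne_top]
          gcongr
          exact Set.Ioc_subset_Icc_self.trans (Set.Icc_subset_Icc_right hs₀.2)
      _ ≤ ENNReal.ofReal (C * D) * ENNReal.ofReal N := by
          rw [← hN']; gcongr; exact le_add_self
      _ = _ := by rw [← ENNReal.ofReal_mul (by positivity)]
  have en := energy u₁ f u hu₁ hf hu hbox hu1 R hR s₀ hs₀.1
  rw [intervalIntegral.integral_add (Continuous.intervalIntegrable (by fun_prop) _ _)
    (Continuous.intervalIntegrable (by fun_prop) _ _), intervalIntegral.integral_const_mul,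
    intervalIntegral.integral_const_mul] at en
  have b2 : ∫ s in (0:ℝ)..s₀, ∫ x in KK R, |ww R u (s, x)| * |GG u₁ f (s, x)| ≤ R * (C * D * N) := by
    calc _ ≤ ∫ s in (0:ℝ)..s₀, C * D * N :=
          intervalIntegral.integral_mono_on hs₀.1 (cGG.intervalIntegrable _ _)
            (Continuous.intervalIntegrable (by fun_prop) _ _)
            fun s hs => bG s ⟨hs.1, hs.2.trans hs₀.2⟩
      _ = s₀ * (C * D * N) := by simp; ring
      _ ≤ _ := by
        have := hs₀.2.trans hRT
        gcongr
  have b3 : 8 / R * (∫ s in (0:ℝ)..s₀, ∫ x in KK R, |ww R u (s, x)| * |GG u₁ f (s, x)|) ≤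
      8 * (C * D * N) := by
    calc _ ≤ 8 / R * (R * (C * D * N)) := by gcongr
      _ = _ := by field_simp
  have b1 := bG s₀ hs₀
  have fin : M ^ 2 ≤ a ^ 2 + 12 * (C * D * N) := by rw [hMsq]; linarith
  set A := 12 * C * Real.sqrt (7 * T) * N with hA
  have hA0 : 0 ≤ A := by positivity
  have fin2 : M ^ 2 ≤ a ^ 2 + A * M := by rw [hA]; rw [hD] at fin; linarith
  have fin3 : M ≤ a + A := by
    by_contra hc
    push Not at hc
    nlinarith
  refine (hM T ⟨hT, le_rfl⟩).trans ?_
  gcongr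

lemma eta_lim (T : ℝ) (x : ℝ × ℝ) : Filter.Tendsto (fun n : ℕ => eta n (T, x)) Filter.atTop (𝓝 1) := by
  have h : Filter.Tendsto (fun n : ℕ => (T + jap x) / (n:ℝ)) Filter.atTop (𝓝 0) :=
    tendsto_const_div_atTop_nhds_zero_nat _
  have h2 := (tendsto_const_nhds (x := (0:ℝ))).max (h.const_sub 1)
  simpa [eta] using! h2

lemma main_est : ∃ C > (0:ℝ), ∀ u₀ u₁ : ℝ × ℝ → ℝ, ∀ f u : Pt → ℝ,
      ContDiff ℝ (⊤ : ℕ∞) u₀ → HasCompactSupport u₀ →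
      ContDiff ℝ (⊤ : ℕ∞) u₁ → HasCompactSupport u₁ →
      ContDiff ℝ (⊤ : ℕ∞) f →
      (∀ τ : ℝ, HasCompactSupport (fun x : ℝ × ℝ => f (τ, x))) →
      ContDiff ℝ (⊤ : ℕ∞) u →
      (∀ p : Pt, 0 ≤ p.1 → box u p = f p) →
      (∀ x : ℝ × ℝ, u (0, x) = u₀ x) → (∀ x : ℝ × ℝ, vdt u (0, x) = u₁ x) →
      ∀ t : ℝ, 0 ≤ t →
        eLpNorm (fun x : ℝ × ℝ => u (t, x)) 2 volume ≤
          eLpNorm u₀ 2 volume +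
            ENNReal.ofReal (C * (1 + t) ^ ((1:ℝ) / 2)) *
              (eLpNorm u₁ (4 / 3) volume + ∫⁻ τ in Set.Icc (0:ℝ) t, Nrm f τ) := by
  obtain ⟨C, hC, hP⟩ := pairing
  refine ⟨12 * C * Real.sqrt 7, by positivity, ?_⟩
  intro u₀ u₁ f u hu₀ hs₀ hu₁ hs₁ hf hfs hu hbox hi0 hi1 T hT
  have o : (1 : WithTop ℕ∞) ≤ ((⊤ : ℕ∞) : WithTop ℕ∞) := by exact_mod_cast le_top
  set Nt := eLpNorm u₁ (4 / 3) volume + ∫⁻ τ in Set.Icc (0:ℝ) T, Nrm f τ with hNt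
  by_cases hNtop : Nt = ⊤
  · rw [hNtop, ENNReal.mul_top (by simp; positivity)]
    simp
  set N := Nt.toReal with hN
  have hNr : Nt = ENNReal.ofReal N := (ENNReal.ofReal_toReal hNtop).symm
  have hN0 : 0 ≤ N := ENNReal.toReal_nonneg
  have cu₀ := hu₀.continuous
  set a := Real.sqrt (∫ x, u₀ x ^ 2) with ha
  have ha0 : 0 ≤ a := Real.sqrt_nonneg _
  have hcs : HasCompactSupport (fun x => u₀ x ^ 2) := by
    refine HasCompactSupport.intro hs₀ fun x hx => ?_
    simp [image_eq_zero_of_notMem_tsupport hx]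
  have int0 : Integrable (fun x => u₀ x ^ 2) :=
    Continuous.integrable_of_hasCompactSupport (by fun_prop) hcs
  have hasq : a ^ 2 = ∫ x, u₀ x ^ 2 := Real.sq_sqrt (integral_nonneg fun x => sq_nonneg _)
  have hae : ENNReal.ofReal a ≤ eLpNorm u₀ 2 volume := by
    rw [eLpNorm_eq_lintegral_rpow_enorm_toReal (by norm_num) (by norm_num)]
    have e : ∫⁻ x, ‖u₀ x‖ₑ ^ (2:ℝ≥0∞).toReal = ENNReal.ofReal a ^ 2 := by
      rw [← ENNReal.ofReal_pow ha0, hasq, ofReal_integral_eq_lintegral_ofReal int0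
        (.of_forall fun x => sq_nonneg _)]
      refine lintegral_congr fun x => ?_
      rw [Real.enorm_eq_ofReal_abs]
      simp only [toReal_ofNat, ENNReal.rpow_ofNat]
      rw [← ENNReal.ofReal_pow (abs_nonneg _), sq_abs]
    rw [e, ← ENNReal.rpow_natCast, ← ENNReal.rpow_mul]; norm_num
  set B := a + 12 * C * Real.sqrt (7 * T) * N with hB
  have hB0 : 0 ≤ B := by positivity
  -- bound for each cutoff
  have cut : ∀ R : ℝ, 0 < R → T ≤ R →
      ∫⁻ x, ENNReal.ofReal (eta R (T, x) ^ 4 * u (T, x) ^ 2) ≤ ENNReal.ofReal (B ^ 2) := by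
    intro R hR hRT
    have cee := ee_cont R u (hu.of_le o)
    have h0 : ∫ x in KK R, ee R u (0, x) ≤ a ^ 2 := by
      rw [hasq]
      refine le_trans ?_ (setIntegral_le_integral (s := KK R) int0 (.of_forall fun x => sq_nonneg _))
      refine setIntegral_mono (KK_int R _ (by fun_prop)) int0.integrableOn fun x => ?_
      have e1 := eta_nonneg R (0, x)
      have e2 := eta_le R hR (0, x) le_rfl
      have e3 : eta R (0, x) ^ 4 ≤ 1 := pow_le_one₀ e1 e2
      simp only [ee, prim, hi0, intervalIntegral.integral_same]
      nlinarith [sq_nonneg (u₀ x)]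
    have h1 := Mbound C hC hP u₁ f u hu₁.continuous hf.continuous hfs hu hbox hi1 T hT N a hN0 ha0
      hNr R hR hRT h0
    calc _ = ∫⁻ x in KK R, ENNReal.ofReal (eta R (T, x) ^ 4 * u (T, x) ^ 2) := by
          rw [setLIntegral_eq_of_support_subset]
          intro x hx
          by_contra hc
          exact hx (by simp [eta_zero R hR (T, x) hT (KK_notMem R x hc)])
      _ ≤ ∫⁻ x in KK R, ENNReal.ofReal (ee R u (T, x)) := by
          refine lintegral_mono fun x => ENNReal.ofReal_le_ofReal ?_
          have e1 := eta_nonneg R (T, x)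
          simp only [ee]
          gcongr
          nlinarith [sq_nonneg (prim (vd1 u) (T, x)), sq_nonneg (prim (vd2 u) (T, x))]
      _ = ENNReal.ofReal (∫ x in KK R, ee R u (T, x)) := by
          rw [ofReal_integral_eq_lintegral_ofReal (KK_int R _ (by fun_prop))]
          refine .of_forall fun x => ?_
          have e1 := eta_nonneg R (T, x)
          simp only [ee, Pi.zero_apply]
          positivity
      _ ≤ _ := ENNReal.ofReal_le_ofReal h1
  have lim : ∫⁻ x, ENNReal.ofReal (u (T, x) ^ 2) ≤ ENNReal.ofReal (B ^ 2) := by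
    have cu := hu.continuous
    calc ∫⁻ x, ENNReal.ofReal (u (T, x) ^ 2)
        = ∫⁻ x, Filter.liminf (fun n : ℕ => ENNReal.ofReal (eta n (T, x) ^ 4 * u (T, x) ^ 2))
            Filter.atTop := by
          refine lintegral_congr fun x => ?_
          have h := ((eta_lim T x).pow 4).mul_const (u (T, x) ^ 2)
          rw [one_pow, one_mul] at h
          exact (ENNReal.tendsto_ofReal h).liminf_eq.symm
      _ ≤ Filter.liminf (fun n : ℕ => ∫⁻ x, ENNReal.ofReal (eta n (T, x) ^ 4 * u (T, x) ^ 2))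
            Filter.atTop := by
          refine lintegral_liminf_le fun n => ?_
          have := eta_cont n
          have c : Continuous fun x => eta n (T, x) ^ 4 * u (T, x) ^ 2 := by fun_prop
          exact c.measurable.ennreal_ofReal
      _ ≤ _ := by
          refine Filter.liminf_le_of_frequently_le' (Filter.Eventually.frequently ?_)
          filter_upwards [Filter.eventually_ge_atTop (Nat.ceil T + 1)] with n hn
          have h1 : ((Nat.ceil T + 1 : ℕ) : ℝ) ≤ n := by exact_mod_cast hn
          push_cast at h1
          have h2 := Nat.le_ceil T
          exact cut n (by linarith) (by linarith)
  have L : eLpNorm (fun x : ℝ × ℝ => u (T, x)) 2 volume ≤ ENNReal.ofReal B := by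
    rw [eLpNorm_eq_lintegral_rpow_enorm_toReal (by norm_num) (by norm_num)]
    have e : ∫⁻ x, ‖u (T, x)‖ₑ ^ (2:ℝ≥0∞).toReal ≤ ENNReal.ofReal B ^ 2 := by
      rw [← ENNReal.ofReal_pow hB0]
      refine le_trans (le_of_eq ?_) lim
      refine lintegral_congr fun x => ?_
      rw [Real.enorm_eq_ofReal_abs]
      simp only [toReal_ofNat, ENNReal.rpow_ofNat]
      rw [← ENNReal.ofReal_pow (abs_nonneg _), sq_abs]
    calc _ ≤ (ENNReal.ofReal B ^ 2) ^ (1 / (2:ℝ≥0∞).toReal) := by gcongr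
      _ = _ := by
        rw [← ENNReal.rpow_natCast, ← ENNReal.rpow_mul]; norm_num
  refine L.trans ?_
  rw [hB, ENNReal.ofReal_add ha0 (by positivity), ENNReal.ofReal_mul (by positivity), hNr]
  have hk : 12 * C * Real.sqrt (7 * T) ≤ 12 * C * Real.sqrt 7 * (1 + T) ^ ((1:ℝ) / 2) := by
    rw [← Real.sqrt_eq_rpow, Real.sqrt_mul (by norm_num), ← mul_assoc]
    have : Real.sqrt T ≤ Real.sqrt (1 + T) := Real.sqrt_le_sqrt (by linarith)
    gcongr
  exact add_le_add hae (mul_le_mul_left (ENNReal.ofReal_le_ofReal hk) _)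
end

/-- The refined `L²` estimate for the inhomogeneous wave equation on `ℝ^{1+2}`:
`‖u(t,·)‖_{L²} ≤ ‖u₀‖_{L²} + C(1+t)^{1/2} {‖u₁‖_{L^{4/3}} + ∫₀ᵗ (‖χ₁f(τ,·)‖_{L^{4/3}}
 + (1+τ)^{−1/2}‖χ₂f(τ,·)‖_{L^{1,2}}) dτ}`. -/
theorem stmt_8 :
    ∃ C > (0:ℝ), ∀ u₀ u₁ : ℝ × ℝ → ℝ, ∀ f u : Pt → ℝ,
      ContDiff ℝ (⊤ : ℕ∞) u₀ → HasCompactSupport u₀ →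
      ContDiff ℝ (⊤ : ℕ∞) u₁ → HasCompactSupport u₁ →
      ContDiff ℝ (⊤ : ℕ∞) f →
      (∀ τ : ℝ, HasCompactSupport (fun x : ℝ × ℝ => f (τ, x))) →
      ContDiff ℝ (⊤ : ℕ∞) u →
      (∀ p : Pt, 0 ≤ p.1 → box u p = f p) →
      (∀ x : ℝ × ℝ, u (0, x) = u₀ x) → (∀ x : ℝ × ℝ, vdt u (0, x) = u₁ x) →
      ∀ t : ℝ, 0 ≤ t →
        eLpNorm (fun x : ℝ × ℝ => u (t, x)) 2 volume ≤
          eLpNorm u₀ 2 volume +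
            ENNReal.ofReal (C * (1 + t) ^ ((1:ℝ) / 2)) *
              (eLpNorm u₁ (4 / 3) volume +
                ∫⁻ τ in Set.Icc (0:ℝ) t,
                  eLpNorm ((chi1Set τ).indicator fun x : ℝ × ℝ => f (τ, x)) (4 / 3) volume
                    + ENNReal.ofReal ((1 + τ) ^ (-(1:ℝ) / 2)
                        * L12norm (((chi1Set τ)ᶜ).indicator fun x : ℝ × ℝ => f (τ, x)))) := by
  exact main_est
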